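/- There exists a constant C > 0 such that for all Schwartz functions w ∈ 𝒮(ℝ^{2n+1}_{t,x,v}) satisfying supp w(·,x,v) ⊂ [−3,3] for every (x,v) ∈ ℝ^{2n}, one has ‖∂_t w + v·∇_x w‖_{L²(ℝ^{2n+1})} ≤ C (‖Pw‖_{L²(ℝ^{2n+1})} + ‖w‖_{L²(ℝ^{2n+1})}). -/

import Mathlib

open MeasureTheory
open scoped ENNReal Real

noncomputable section

/-- `ℝ^n` with the Euclidean norm. -/
abbrev E (n : ℕ) : Type := EuclideanSpace ℝ (Fin n)
/-- `ℝ^{2n+1} = ℝ_t × ℝ^n_x × ℝ^n_v` with the Euclidean norm. -/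
abbrev Z (n : ℕ) : Type := EuclideanSpace ℝ (Unit ⊕ Fin n ⊕ Fin n)

variable {n : ℕ}

/-- the `t` (resp. dual `τ`) coordinate -/
def tC (ζ : Z n) : ℝ := ζ (Sum.inl ())
/-- the `x` (resp. dual `ξ`) coordinates -/
def xC (ζ : Z n) : E n := WithLp.toLp 2 (fun i => ζ (Sum.inr (Sum.inl i)))
/-- the `v` (resp. dual `η`) coordinates -/
def vC (ζ : Z n) : E n := WithLp.toLp 2 (fun i => ζ (Sum.inr (Sum.inr i)))

/-- the unit vector in the `t` direction -/
def eT : Z n := EuclideanSpace.single (Sum.inl ()) 1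
/-- the unit vector in the `xᵢ` direction -/
def eX (i : Fin n) : Z n := EuclideanSpace.single (Sum.inr (Sum.inl i)) 1

/-- the symbol `F(η) = |η|^{2σ} w(η) + |η|² (1 - w(η))` -/
def Fsym (σ : ℝ) (w : E n → ℝ) (η : E n) : ℝ :=
  ‖η‖ ^ (2 * σ) * w η + ‖η‖ ^ 2 * (1 - w η)

/-- the fractional Laplacian `(-Δ̃_v)^σ`, the Fourier multiplier with symbol `F(η)` -/
def fracLap (σ : ℝ) (w : E n → ℝ) (u : Z n → ℂ) : Z n → ℂ :=
  FourierTransformInv.fourierInv (fun ζ : Z n => (Fsym σ w (vC ζ) : ℂ) * FourierTransform.fourier u ζ)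

/-- the kinetic operator `P = ∂_t + v⋅∂_x + a(t,x,v) (-Δ̃_v)^σ` -/
def Pop (σ : ℝ) (w : E n → ℝ) (a : Z n → ℝ) (u : Z n → ℂ) (z : Z n) : ℂ :=
  fderiv ℝ u z eT + ∑ i : Fin n, (vC z i : ℂ) * fderiv ℝ u z (eX i)
    + (a z : ℂ) * fracLap σ w u z

namespace KinMax
section P1
set_option linter.unusedSectionVars false
open scoped FourierTransform SchwartzMap InnerProductSpace

variable {V : Type*} [NormedAddCommGroup V] [InnerProductSpace ℝ V] [FiniteDimensional ℝ V]
  [MeasurableSpace V] [BorelSpace V]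

/-- squared `L²` norm as a lower Lebesgue integral -/
def N2 {X : Type*} [MeasureSpace X] (f : X → ℂ) : ℝ≥0∞ := ∫⁻ x, ‖f x‖ₑ ^ 2

lemma enorm_add_sq_le (a b : ℂ) : ‖a + b‖ₑ ^ 2 ≤ 2 * ‖a‖ₑ ^ 2 + 2 * ‖b‖ₑ ^ 2 := by
  have h : ‖a + b‖ ^ 2 ≤ 2 * ‖a‖ ^ 2 + 2 * ‖b‖ ^ 2 := by
    have := norm_add_le a b
    nlinarith [sq_nonneg (‖a‖ - ‖b‖), norm_nonneg (a + b), norm_nonneg a, norm_nonneg b]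
  have e : ∀ z : ℂ, ‖z‖ₑ ^ 2 = ENNReal.ofReal (‖z‖ ^ 2) := fun z => by
    rw [← ofReal_norm, ENNReal.ofReal_pow (norm_nonneg _)]
  have e2 : (2 : ℝ≥0∞) = ENNReal.ofReal 2 := by simp
  rw [e, e, e, e2, ← ENNReal.ofReal_mul (by norm_num), ← ENNReal.ofReal_mul (by norm_num),
    ← ENNReal.ofReal_add (by positivity) (by positivity)]
  exact ENNReal.ofReal_le_ofReal h

lemma N2_eq_integral {X : Type*} [MeasureSpace X] (f : X → ℂ)
    (hf : Integrable (fun x => ‖f x‖ ^ 2)) : N2 f = ENNReal.ofReal (∫ x, ‖f x‖ ^ 2) := by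
  rw [ofReal_integral_eq_lintegral_ofReal hf (Filter.Eventually.of_forall fun x => by positivity)]
  unfold N2
  congr 1; ext x
  rw [← ofReal_norm, ENNReal.ofReal_pow (norm_nonneg _)]

lemma schwartz_sq_integrable {W : Type*} [NormedAddCommGroup W] [NormedSpace ℝ W]
    [MeasurableSpace W] [BorelSpace W] [SecondCountableTopology W] (μ : Measure W)
    [μ.HasTemperateGrowth] (f : 𝓢(W, ℂ)) :
    Integrable (fun x => ‖f x‖ ^ 2) μ := by
  have := (f.memLp 2 μ)
  exact (memLp_two_iff_integrable_sq_norm f.continuous.aestronglyMeasurable).1 this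

lemma N2_schwartz_lt_top (f : 𝓢(V, ℂ)) : N2 f < ∞ := by
  rw [N2_eq_integral _ (schwartz_sq_integrable _ f)]; exact ENNReal.ofReal_lt_top

lemma plancherel (f : 𝓢(V, ℂ)) : N2 (𝓕 (f : V → ℂ)) = N2 f := by
  have h : (𝓕 (f : V → ℂ)) = ((𝓕 f : 𝓢(V, ℂ)) : V → ℂ) := (SchwartzMap.fourier_coe f).symm
  rw [h, N2_eq_integral _ (schwartz_sq_integrable _ f),
    N2_eq_integral _ (schwartz_sq_integrable _ (𝓕 f)), SchwartzMap.integral_norm_sq_fourier]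

/-- short-time Fourier transform -/
def T (ψ : 𝓢(V, ℂ)) (f : V → ℂ) (q ζ : V) : ℂ := 𝓕 (fun s => ψ (s - q) * f s) ζ

lemma T_eq (ψ : 𝓢(V, ℂ)) (f : V → ℂ) (q ζ : V) :
    T ψ f q ζ = ∫ s, Real.fourierChar (-⟪s, ζ⟫_ℝ) • (ψ (s - q) * f s) := by
  rw [T, Real.fourier_eq]

/-- the localized function -/
def loc (ψ : 𝓢(V, ℂ)) (f : 𝓢(V, ℂ)) (q : V) : 𝓢(V, ℂ) :=
  SchwartzMap.smulLeftCLM ℂ (ψ.compSubConstCLM ℂ q) f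

lemma loc_apply (ψ : 𝓢(V, ℂ)) (f : 𝓢(V, ℂ)) (q s : V) : loc ψ f q s = ψ (s - q) * f s := by
  rw [loc, SchwartzMap.smulLeftCLM_apply_apply (by fun_prop)]; simp

lemma T_add (ψ : 𝓢(V, ℂ)) (f g : 𝓢(V, ℂ)) (c : ℂ) (q ζ : V) :
    T ψ (fun s => f s + c * g s) q ζ = T ψ f q ζ + c * T ψ g q ζ := by
  have hi : ∀ f : 𝓢(V, ℂ), Integrable
      (fun s => Real.fourierChar (-⟪s, ζ⟫_ℝ) • (ψ (s - q) * f s)) := by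
    intro f
    rw [Real.fourierIntegral_convergent_iff]
    have := (loc ψ f q).integrable (μ := volume)
    refine this.congr (Filter.Eventually.of_forall fun s => ?_)
    exact loc_apply ψ f q s
  rw [T_eq, T_eq, T_eq, ← integral_const_mul, ← integral_add (hi f) ((hi g).const_mul c)]
  congr 1; ext s
  simp only [Circle.smul_def, smul_eq_mul]; ring

lemma T_plancherel (ψ f : 𝓢(V, ℂ)) (q : V) :
    ∫⁻ ζ, ‖T ψ f q ζ‖ₑ ^ 2 = ∫⁻ s, ‖ψ (s - q)‖ₑ ^ 2 * ‖f s‖ₑ ^ 2 := by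
  have h := plancherel (loc ψ f q)
  unfold N2 at h
  have e : (loc ψ f q : V → ℂ) = fun s => ψ (s - q) * f s := by ext s; exact loc_apply _ _ _ _
  rw [e] at h
  rw [show (∫⁻ ζ, ‖T ψ f q ζ‖ₑ ^ 2) = _ from h]
  congr 1; ext s
  rw [enorm_mul, mul_pow]

lemma weight_integral (ψ : 𝓢(V, ℂ)) (f : V → ℝ≥0∞) (hf : Measurable f) :
    ∫⁻ q, ∫⁻ s, ‖ψ (s - q)‖ₑ ^ 2 * f s = N2 ψ * ∫⁻ s, f s := by
  rw [lintegral_lintegral_swap]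
  · have : ∀ s : V, ∫⁻ q, ‖ψ (s - q)‖ₑ ^ 2 * f s = N2 ψ * f s := by
      intro s
      have hc : Continuous fun q : V => ψ (s - q) := by fun_prop
      rw [lintegral_mul_const _ (hc.measurable.enorm.pow_const 2)]
      congr 1
      exact lintegral_sub_left_eq_self (fun q => ‖ψ q‖ₑ ^ 2) s
    simp_rw [this]
    rw [lintegral_const_mul _ hf]
  · apply Measurable.aemeasurable
    apply Measurable.mul
    · have : Continuous fun x : V × V => ψ (x.2 - x.1) := by fun_prop
      exact this.measurable.enorm.pow_const 2
    · exact hf.comp measurable_snd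

lemma moyal (ψ f : 𝓢(V, ℂ)) : ∫⁻ q, ∫⁻ ζ, ‖T ψ f q ζ‖ₑ ^ 2 = N2 ψ * N2 f := by
  simp_rw [T_plancherel]
  exact weight_integral ψ _ (f.continuous.measurable.enorm.pow_const 2)


/-- modulation of a Schwartz function -/
def modul (f : 𝓢(V, ℂ)) (ζ : V) : 𝓢(V, ℂ) := 𝓕⁻ ((𝓕 f).compSubConstCLM ℂ (-ζ))

lemma modul_apply (f : 𝓢(V, ℂ)) (ζ s : V) :
    modul f ζ s = Real.fourierChar (-⟪s, ζ⟫_ℝ) • f s := by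
  have h1 : modul f ζ s = 𝓕⁻ (fun θ : V => (𝓕 f : 𝓢(V, ℂ)) (θ + ζ)) s := by
    have h0 : ⇑((𝓕 f : 𝓢(V, ℂ)).compSubConstCLM ℂ (-ζ)) = fun θ => (𝓕 f : 𝓢(V, ℂ)) (θ + ζ) := by
      ext θ; simp
    rw [modul, SchwartzMap.fourierInv_coe, h0]
  have h2 : f s = 𝓕⁻ (fun θ : V => (𝓕 f : 𝓢(V, ℂ)) θ) s := by
    conv_lhs => rw [← FourierTransform.fourierInv_fourier_eq (F := 𝓢(V, ℂ)) f]
    rw [SchwartzMap.fourierInv_coe]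
  rw [h1, h2, Real.fourierInv_eq, Real.fourierInv_eq]
  have := integral_add_right_eq_self (μ := (volume : Measure V))
    (fun v => Real.fourierChar (⟪v - ζ, s⟫_ℝ) • (𝓕 f) v) ζ
  simp only [add_sub_cancel_right] at this
  rw [this, Circle.smul_def, ← integral_smul]
  congr 1; ext v
  rw [inner_sub_left, sub_eq_add_neg, AddChar.map_add_eq_mul, real_inner_comm ζ s]
  simp only [Circle.smul_def, smul_eq_mul, Circle.coe_mul]
  ring

lemma fourier_modul (f : 𝓢(V, ℂ)) (ζ θ : V) : 𝓕 (modul f ζ) θ = 𝓕 f (θ + ζ) := by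
  rw [modul, FourierTransform.fourier_fourierInv_eq]
  simp

/-- reflection -/
def refl (ψ : 𝓢(V, ℂ)) : 𝓢(V, ℂ) :=
  SchwartzMap.compCLMOfContinuousLinearEquiv ℂ (ContinuousLinearEquiv.neg ℝ) ψ

lemma refl_apply (ψ : 𝓢(V, ℂ)) (s : V) : refl ψ s = ψ (-s) := rfl

lemma T_eq_conv (ψ f : 𝓢(V, ℂ)) (q ζ : V) :
    T ψ f q ζ = SchwartzMap.convolution (ContinuousLinearMap.mul ℂ ℂ) (modul f ζ) (refl ψ) q := by
  rw [SchwartzMap.convolution_apply, convolution_def, T_eq]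
  congr 1; ext s
  simp only [modul_apply, refl_apply, ContinuousLinearMap.mul_apply', neg_sub, Circle.smul_def,
    smul_eq_mul]
  ring

lemma comm_plancherel (ψ f l : 𝓢(V, ℂ)) (m : V → ℝ)
    (hl : ∀ ζ, 𝓕 l ζ = (m ζ : ℂ) * 𝓕 f ζ) (ζ : V) :
    ∫⁻ q, ‖(m ζ : ℂ) * T ψ f q ζ - T ψ l q ζ‖ₑ ^ 2 =
      ∫⁻ θ, ‖𝓕 (refl ψ) θ‖ₑ ^ 2 * (‖m ζ - m (ζ + θ)‖ₑ ^ 2 * ‖𝓕 f (ζ + θ)‖ₑ ^ 2) := by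
  let B := ContinuousLinearMap.mul ℂ ℂ
  let Φ : 𝓢(V, ℂ) := (m ζ : ℂ) • SchwartzMap.convolution B (modul f ζ) (refl ψ)
    - SchwartzMap.convolution B (modul l ζ) (refl ψ)
  have h1 : ∀ q, Φ q = (m ζ : ℂ) * T ψ f q ζ - T ψ l q ζ := by
    intro q
    simp [Φ, T_eq_conv, B]
  have h2 : ∀ θ, 𝓕 Φ θ = 𝓕 (refl ψ) θ * (((m ζ - m (ζ + θ) : ℝ) : ℂ) * 𝓕 f (ζ + θ)) := by
    intro θ
    have : 𝓕 Φ = (m ζ : ℂ) • 𝓕 (SchwartzMap.convolution B (modul f ζ) (refl ψ))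
      - 𝓕 (SchwartzMap.convolution B (modul l ζ) (refl ψ)) := by
      simp only [Φ, ← SchwartzMap.fourierTransformCLM_apply ℂ, map_sub, map_smul]
    rw [this]
    simp only [SchwartzMap.fourier_convolution, sub_apply, smul_apply,
      SchwartzMap.pairing_apply_apply, fourier_modul, B, ContinuousLinearMap.mul_apply', hl,
      smul_eq_mul, add_comm θ ζ]
    push_cast
    ring
  have h3 := plancherel Φ
  unfold N2 at h3
  rw [← SchwartzMap.fourier_coe] at h3
  simp_rw [h1] at h3
  rw [← h3]
  congr 1; ext θ
  rw [h2, enorm_mul, enorm_mul, mul_pow, mul_pow]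
  congr 3
  rw [← ofReal_norm, ← ofReal_norm, Complex.norm_real]

lemma comm_bound (ψ : 𝓢(V, ℂ)) (m : V → ℝ) (hm : Continuous m) (hm0 : ∀ ζ, 0 ≤ m ζ)
    (ε C : ℝ) (hε : 0 ≤ ε) (hC : 0 ≤ C)
    (hM : ∀ ζ θ, |m ζ - m (ζ + θ)| ≤ ε * m (ζ + θ) + C * (1 + ‖θ‖) ^ 2) :
    ∃ K : ℝ≥0∞, K < ∞ ∧ ∀ f l : 𝓢(V, ℂ), (∀ ζ, 𝓕 l ζ = (m ζ : ℂ) * 𝓕 f ζ) →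
    (∫⁻ ζ, ∫⁻ q, ‖(m ζ : ℂ) * T ψ f q ζ - T ψ l q ζ‖ₑ ^ 2) ≤
      ENNReal.ofReal (2 * ε ^ 2) * (N2 ψ * N2 l) + K * N2 f := by
  have hψ : N2 (𝓕 (refl ψ) : 𝓢(V, ℂ)) = N2 ψ := by
    rw [SchwartzMap.fourier_coe, plancherel]
    unfold N2
    simp_rw [refl_apply]
    exact lintegral_neg_eq_self (fun s => ‖ψ s‖ₑ ^ 2)
  let w : V → ℝ≥0∞ := fun θ => ENNReal.ofReal (2 * C ^ 2 * (1 + ‖θ‖) ^ 4)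
  have hw : Measurable w := by fun_prop
  refine ⟨∫⁻ θ, ‖𝓕 (refl ψ) θ‖ₑ ^ 2 * w θ, ?_, ?_⟩
  · let G : 𝓢(V, ℂ) := SchwartzMap.smulLeftCLM ℂ (fun θ : V => (1 + ‖θ‖ ^ 2 : ℝ)) (𝓕 (refl ψ))
    have hG : ∀ θ, ‖𝓕 (refl ψ) θ‖ₑ ^ 2 * w θ ≤ ENNReal.ofReal (8 * C ^ 2) * ‖G θ‖ₑ ^ 2 := by
      intro θ
      have : G θ = (1 + ‖θ‖ ^ 2 : ℝ) • 𝓕 (refl ψ) θ :=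
        SchwartzMap.smulLeftCLM_apply_apply (by fun_prop) _ _
      rw [this, enorm_smul, mul_pow, mul_comm, ← mul_assoc]
      gcongr
      rw [← ofReal_norm, ← ENNReal.ofReal_pow (norm_nonneg _), ← ENNReal.ofReal_mul (by positivity)]
      apply ENNReal.ofReal_le_ofReal
      rw [Real.norm_of_nonneg (by positivity)]
      have h1 : (1 + ‖θ‖) ^ 2 ≤ 2 * (1 + ‖θ‖ ^ 2) := by nlinarith [sq_nonneg (1 - ‖θ‖)]
      have h2 : (1 + ‖θ‖) ^ 4 ≤ (2 * (1 + ‖θ‖ ^ 2)) ^ 2 := by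
        calc (1 + ‖θ‖) ^ 4 = ((1 + ‖θ‖) ^ 2) ^ 2 := by ring
          _ ≤ _ := by gcongr
      nlinarith [sq_nonneg C]
    refine (lintegral_mono hG).trans_lt ?_
    rw [lintegral_const_mul _ (G.continuous.measurable.enorm.pow_const 2)]
    exact ENNReal.mul_lt_top ENNReal.ofReal_lt_top (N2_schwartz_lt_top G)
  intro f l hl
  have hmm : Measurable m := hm.measurable
  have hfm : Measurable (𝓕 f : 𝓢(V, ℂ)) := (𝓕 f).continuous.measurable
  have hpm : Measurable (𝓕 (refl ψ) : 𝓢(V, ℂ)) := (𝓕 (refl ψ)).continuous.measurable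
  simp_rw [comm_plancherel ψ f l m hl]
  rw [lintegral_lintegral_swap (by fun_prop)]
  have key : ∀ θ, ∫⁻ ζ, ‖𝓕 (refl ψ) θ‖ₑ ^ 2 * (‖m ζ - m (ζ + θ)‖ₑ ^ 2 * ‖𝓕 f (ζ + θ)‖ₑ ^ 2)
      ≤ ‖𝓕 (refl ψ) θ‖ₑ ^ 2 * (ENNReal.ofReal (2 * ε ^ 2) * N2 l)
        + (‖𝓕 (refl ψ) θ‖ₑ ^ 2 * w θ) * N2 f := by
    intro θ
    rw [lintegral_const_mul _ (by fun_prop), mul_assoc, ← mul_add]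
    gcongr
    have hp : ∀ ζ, ‖m ζ - m (ζ + θ)‖ₑ ^ 2 * ‖𝓕 f (ζ + θ)‖ₑ ^ 2 ≤
        ENNReal.ofReal (2 * ε ^ 2) * ‖𝓕 l (ζ + θ)‖ₑ ^ 2 + w θ * ‖𝓕 f (ζ + θ)‖ₑ ^ 2 := by
      intro ζ
      rw [hl, enorm_mul, mul_pow, ← mul_assoc, ← add_mul]
      gcongr
      rw [← ofReal_norm, ← ofReal_norm, Complex.norm_real, ← ENNReal.ofReal_pow (norm_nonneg _),
        ← ENNReal.ofReal_pow (norm_nonneg _), ← ENNReal.ofReal_mul (by positivity),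
        ← ENNReal.ofReal_add (by positivity) (by positivity)]
      apply ENNReal.ofReal_le_ofReal
      have h1 := hM ζ θ
      have h2 := hm0 (ζ + θ)
      rw [Real.norm_eq_abs, Real.norm_eq_abs, abs_of_nonneg h2]
      calc |m ζ - m (ζ + θ)| ^ 2 ≤ (ε * m (ζ + θ) + C * (1 + ‖θ‖) ^ 2) ^ 2 := by gcongr
        _ ≤ _ := by nlinarith [sq_nonneg (ε * m (ζ + θ) - C * (1 + ‖θ‖) ^ 2)]
    refine (lintegral_mono hp).trans ?_
    have hlm : Measurable (𝓕 l : 𝓢(V, ℂ)) := (𝓕 l).continuous.measurable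
    rw [lintegral_add_left (by fun_prop), lintegral_const_mul _ (by fun_prop),
      lintegral_const_mul _ (by fun_prop),
      lintegral_add_right_eq_self (fun ζ => ‖𝓕 l ζ‖ₑ ^ 2) θ,
      lintegral_add_right_eq_self (fun ζ => ‖𝓕 f ζ‖ₑ ^ 2) θ]
    have e1 := plancherel l
    have e2 := plancherel f
    rw [← SchwartzMap.fourier_coe] at e1 e2
    rw [← e1, ← e2]
    rfl
  refine (lintegral_mono key).trans ?_
  rw [lintegral_add_left (by fun_prop), lintegral_mul_const _ (by fun_prop),
    lintegral_mul_const _ (by fun_prop), ← hψ]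
  apply le_of_eq
  unfold N2
  ring

end P1
end KinMax

namespace KinMax
section P2

lemma cs_lintegral {X : Type*} [MeasurableSpace X] (μ : Measure X) (e k : X → ℝ≥0∞)
    (he : AEMeasurable e μ) (hk : AEMeasurable k μ) :
    (∫⁻ x, e x * k x ∂μ) ^ 2 ≤ (∫⁻ x, e x ∂μ) * ∫⁻ x, e x * k x ^ 2 ∂μ := by
  have h := ENNReal.lintegral_mul_le_Lp_mul_Lq μ (p := 2) (q := 2) Real.HolderConjugate.two_two
    (f := fun x => e x ^ (1 / 2 : ℝ)) (g := fun x => e x ^ (1 / 2 : ℝ) * k x)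
    (he.pow_const _) ((he.pow_const _).mul hk)
  have hs : ∀ x : ℝ≥0∞, x ^ (1 / 2 : ℝ) * x ^ (1 / 2 : ℝ) = x := fun x => by
    rw [← ENNReal.rpow_add_of_nonneg _ _ (by norm_num) (by norm_num)]; norm_num
  have e1 : ∀ x : ℝ≥0∞, (x ^ (1 / 2 : ℝ)) ^ (2 : ℝ) = x := fun x => by
    rw [← ENNReal.rpow_mul]; norm_num
  have e2 : ∀ x : ℝ≥0∞, (x ^ (1 / 2 : ℝ)) ^ 2 = x := fun x => by
    rw [pow_two, hs]
  simp only [Pi.mul_apply, ← mul_assoc, hs, e1] at h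
  calc _ ≤ _ := pow_le_pow_left' h 2
    _ = _ := by
      rw [mul_pow, e2, e2]
      congr 2; ext x
      rw [ENNReal.mul_rpow_of_nonneg _ _ (by norm_num), e1]
      norm_num

lemma ode_lemma (g k : ℝ → ℂ) (α m : ℝ → ℝ) (a0 c : ℝ) (ha0 : 0 < a0) (hc : 0 < c)
    (hk : Continuous k) (hα : Continuous α) (hm : Continuous m) (hm0 : ∀ t, 0 ≤ m t)
    (hαl : ∀ t, a0 ≤ α t)
    (hg : ∀ t, HasDerivAt g (k t - α t * m t * g t) t)
    (hg0 : ∀ t, t ∉ Set.Ioc (-4 : ℝ) 4 → g t = 0)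
    (hmc : ∀ s t, s ≤ t → c * (t - s) * m t ≤ ∫ r in s..t, m r) :
    ∫⁻ t, (ENNReal.ofReal (m t)) ^ 2 * ‖g t‖ₑ ^ 2
      ≤ ENNReal.ofReal (1 / (a0 ^ 2 * c)) * ∫⁻ t, ‖k t‖ₑ ^ 2 := by
  let M : ℝ → ℝ := fun t => ∫ r in (-4 : ℝ)..t, m r
  let B : ℝ → ℝ := fun t => ∫ r in (-4 : ℝ)..t, α r * m r
  have hM : ∀ t, HasDerivAt M (m t) t := fun t => hm.integral_hasStrictDerivAt _ _ |>.hasDerivAt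
  have hB : ∀ t, HasDerivAt B (α t * m t) t :=
    fun t => (hα.mul hm).integral_hasStrictDerivAt _ _ |>.hasDerivAt
  have hMc : Continuous M := continuous_iff_continuousAt.2 fun t => (hM t).continuousAt
  have hBc : Continuous B := continuous_iff_continuousAt.2 fun t => (hB t).continuousAt
  have hMd : ∀ s t, M t - M s = ∫ r in s..t, m r := fun s t =>
    intervalIntegral.integral_interval_sub_left (hm.intervalIntegrable _ _)
      (hm.intervalIntegrable _ _)
  have hBd : ∀ s t, B t - B s = ∫ r in s..t, α r * m r := fun s t =>
    intervalIntegral.integral_interval_sub_left ((hα.mul hm).intervalIntegrable _ _)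
      ((hα.mul hm).intervalIntegrable _ _)
  have hBM : ∀ s t, s ≤ t → a0 * (M t - M s) ≤ B t - B s := by
    intro s t hst
    rw [hMd, hBd, ← intervalIntegral.integral_const_mul]
    apply intervalIntegral.integral_mono_on hst
    · exact (continuous_const.mul hm).intervalIntegrable _ _
    · exact (hα.mul hm).intervalIntegrable _ _
    · intro x _
      exact mul_le_mul_of_nonneg_right (hαl x) (hm0 x)
  let e : ℝ → ℝ → ℝ≥0∞ := fun t s =>
    Set.indicator (Set.Ici s) (fun t => ENNReal.ofReal (Real.exp (-(a0 * (M t - M s))))) t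
  -- Duhamel
  have duh : ∀ t ∈ Set.Ioc (-4 : ℝ) 4, ‖g t‖ₑ ≤ ∫⁻ s in Set.Ioc (-4 : ℝ) 4, e t s * ‖k s‖ₑ := by
    intro t ht
    have hd : ∀ s, HasDerivAt (fun s => (Real.exp (B s) : ℂ) * g s) (Real.exp (B s) * k s) s := by
      intro s
      have h1 : HasDerivAt (fun s => ((Real.exp (B s) : ℝ) : ℂ))
          ((Real.exp (B s) * (α s * m s) : ℝ) : ℂ) s := ((hB s).exp).ofReal_comp
      exact (h1.mul (hg s)).congr_deriv (by push_cast; ring)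
    have hcont : Continuous fun s => (Real.exp (B s) : ℂ) * k s := by fun_prop
    have h2 := intervalIntegral.integral_eq_sub_of_hasDerivAt (a := -4) (b := t)
      (fun s _ => hd s) (hcont.intervalIntegrable _ _)
    rw [hg0 (-4) (by simp), mul_zero, sub_zero] at h2
    have h3 : g t = ∫ s in (-4 : ℝ)..t, (Real.exp (B s - B t) : ℂ) * k s := by
      have : ∀ s, (Real.exp (B s - B t) : ℂ) * k s
          = (Real.exp (-B t) : ℂ) * ((Real.exp (B s) : ℂ) * k s) := by
        intro s
        rw [sub_eq_add_neg, add_comm, Real.exp_add]; push_cast; ring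
      simp_rw [this]
      rw [intervalIntegral.integral_const_mul, h2, ← mul_assoc, ← Complex.ofReal_mul,
        ← Real.exp_add]
      simp
    rw [h3, intervalIntegral.integral_of_le ht.1.le]
    refine (enorm_integral_le_lintegral_enorm _).trans ?_
    calc _ ≤ ∫⁻ s in Set.Ioc (-4 : ℝ) t, e t s * ‖k s‖ₑ := by
          apply setLIntegral_mono' measurableSet_Ioc
          intro s hs
          rw [enorm_mul]
          gcongr
          simp only [e]
          rw [Set.indicator_of_mem (by exact hs.2), ← ofReal_norm, Complex.norm_real,
            Real.norm_of_nonneg (Real.exp_pos _).le]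
          apply ENNReal.ofReal_le_ofReal
          apply Real.exp_le_exp.2
          have := hBM s t hs.2
          linarith
      _ ≤ _ := lintegral_mono_set (Set.Ioc_subset_Ioc_right ht.2)
  have hem : Measurable (fun p : ℝ × ℝ => e p.1 p.2) := by
    have : (fun p : ℝ × ℝ => e p.1 p.2) = Set.indicator {p : ℝ × ℝ | p.2 ≤ p.1}
        (fun p => ENNReal.ofReal (Real.exp (-(a0 * (M p.1 - M p.2))))) := by
      ext p
      simp only [e, Set.indicator, Set.mem_Ici, Set.mem_ofPred_eq]
    rw [this]
    apply Measurable.indicator _ (measurableSet_le measurable_snd measurable_fst)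
    have : Continuous fun p : ℝ × ℝ => Real.exp (-(a0 * (M p.1 - M p.2))) := by fun_prop
    exact this.measurable.ennreal_ofReal
  have he1 : ∀ t, Measurable (e t) := fun t => hem.comp measurable_prodMk_left
  have he2 : ∀ s, Measurable (fun t => e t s) := fun t => hem.comp measurable_prodMk_right
  have hkm : Measurable k := hk.measurable
  have hmm : Measurable m := hm.measurable
  -- first kernel bound
  have k1 : ∀ t ∈ Set.Ioc (-4 : ℝ) 4, ENNReal.ofReal (m t) * ∫⁻ s in Set.Ioc (-4 : ℝ) 4, e t s
      ≤ ENNReal.ofReal (1 / (a0 * c)) := by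
    intro t ht
    rw [← lintegral_const_mul _ (he1 t)]
    let b := a0 * c * m t
    have hpt : ∀ s, ENNReal.ofReal (m t) * e t s ≤ Set.indicator (Set.Iic t)
        (fun s => ENNReal.ofReal (1 / (a0 * c) * (b * Real.exp (-(b * (t - s)))))) s := by
      intro s
      by_cases hs : s ≤ t
      · simp only [e]
        rw [Set.indicator_of_mem (by exact hs), Set.indicator_of_mem (by exact hs),
          ← ENNReal.ofReal_mul (hm0 t)]
        apply ENNReal.ofReal_le_ofReal
        have h1 : 1 / (a0 * c) * (b * Real.exp (-(b * (t - s))))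
          = m t * Real.exp (-(b * (t - s))) := by
          simp only [b]; field_simp
        rw [h1]
        apply mul_le_mul_of_nonneg_left _ (hm0 t)
        apply Real.exp_le_exp.2
        have := hmc s t hs
        rw [hMd]
        simp only [b]
        nlinarith
      · simp only [e]
        rw [Set.indicator_of_notMem (by simpa using hs)]; simp
    refine (lintegral_mono hpt).trans ?_
    rw [lintegral_indicator measurableSet_Iic, Measure.restrict_restrict measurableSet_Iic]
    have hset : Set.Iic t ∩ Set.Ioc (-4 : ℝ) 4 = Set.Ioc (-4) t := by
      ext x; simp only [Set.mem_inter_iff, Set.mem_Iic, Set.mem_Ioc]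
      have := ht.2
      constructor
      · rintro ⟨h1, h2, h3⟩; exact ⟨h2, h1⟩
      · rintro ⟨h1, h2⟩; exact ⟨h2, h1, by linarith⟩
    rw [hset]
    have hb0 : 0 ≤ b := by have := hm0 t; positivity
    have hcont : Continuous fun s => 1 / (a0 * c) * (b * Real.exp (-(b * (t - s)))) := by fun_prop
    rw [← ofReal_integral_eq_lintegral_ofReal (hcont.integrableOn_Ioc)
      (Filter.Eventually.of_forall fun s => by positivity),
      ← intervalIntegral.integral_of_le ht.1.le, intervalIntegral.integral_const_mul]
    apply ENNReal.ofReal_le_ofReal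
    have hd : ∀ s, HasDerivAt (fun s => Real.exp (-(b * (t - s))))
        (b * Real.exp (-(b * (t - s)))) s := by
      intro s
      have h1 : HasDerivAt (fun s => -(b * (t - s))) b s := by
        exact (((hasDerivAt_id s).const_sub t).const_mul b).neg.congr_deriv (by simp)
      exact h1.exp.congr_deriv (by ring)
    have hcont' : Continuous fun s => (b * Real.exp (-(b * (t - s)))) := by fun_prop
    rw [intervalIntegral.integral_eq_sub_of_hasDerivAt (fun s _ => hd s)
      (hcont'.intervalIntegrable _ _)]
    have := Real.exp_pos (-(b * (t - -4)))
    have h5 : (0:ℝ) ≤ 1 / (a0 * c) := by positivity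
    simp only [sub_self, mul_zero, neg_zero, Real.exp_zero]
    nlinarith
  have k2 : ∀ s ∈ Set.Ioc (-4 : ℝ) 4, ∫⁻ t in Set.Ioc (-4 : ℝ) 4, ENNReal.ofReal (m t) * e t s
      ≤ ENNReal.ofReal (1 / a0) := by
    intro s hs
    have hpt : ∀ t, ENNReal.ofReal (m t) * e t s = Set.indicator (Set.Ici s)
        (fun t => ENNReal.ofReal (1 / a0 * (a0 * m t * Real.exp (-(a0 * (M t - M s)))))) t := by
      intro t
      by_cases hst : s ≤ t
      · simp only [e]
        rw [Set.indicator_of_mem (by exact hst), Set.indicator_of_mem (by exact hst),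
          ← ENNReal.ofReal_mul (hm0 t)]
        congr 1; field_simp
      · simp only [e]
        rw [Set.indicator_of_notMem (by simpa using hst),
          Set.indicator_of_notMem (by simpa using hst)]; simp
    simp_rw [hpt]
    rw [lintegral_indicator measurableSet_Ici, Measure.restrict_restrict measurableSet_Ici]
    have hset : Set.Ici s ∩ Set.Ioc (-4 : ℝ) 4 = Set.Icc s 4 := by
      ext x; simp only [Set.mem_inter_iff, Set.mem_Ici, Set.mem_Ioc, Set.mem_Icc]
      have := hs.1
      constructor
      · rintro ⟨h1, h2, h3⟩; exact ⟨h1, h3⟩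
      · rintro ⟨h1, h2⟩; exact ⟨h1, by linarith, h2⟩
    rw [hset]
    have hcont : Continuous fun t => 1 / a0 * (a0 * m t * Real.exp (-(a0 * (M t - M s)))) := by
      fun_prop
    rw [← ofReal_integral_eq_lintegral_ofReal (hcont.integrableOn_Icc)
      (Filter.Eventually.of_forall fun t => by have := hm0 t; positivity),
      integral_Icc_eq_integral_Ioc,
      ← intervalIntegral.integral_of_le hs.2, intervalIntegral.integral_const_mul]
    apply ENNReal.ofReal_le_ofReal
    have hd : ∀ t, HasDerivAt (fun t => -Real.exp (-(a0 * (M t - M s))))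
        (a0 * m t * Real.exp (-(a0 * (M t - M s)))) t := by
      intro t
      have h1 : HasDerivAt (fun t => -(a0 * (M t - M s))) (-(a0 * m t)) t :=
        (((hM t).sub_const _).const_mul a0).neg
      exact h1.exp.neg.congr_deriv (by ring)
    have hcont' : Continuous fun t => (a0 * m t * Real.exp (-(a0 * (M t - M s)))) := by fun_prop
    rw [intervalIntegral.integral_eq_sub_of_hasDerivAt (fun s _ => hd s)
      (hcont'.intervalIntegrable _ _)]
    have := Real.exp_pos (-(a0 * (M 4 - M s)))
    have h5 : (0:ℝ) ≤ 1 / a0 := by positivity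
    simp only [sub_self, mul_zero, neg_zero, Real.exp_zero]
    nlinarith
  -- restrict to the time window
  have hres : ∫⁻ t, (ENNReal.ofReal (m t)) ^ 2 * ‖g t‖ₑ ^ 2
      = ∫⁻ t in Set.Ioc (-4 : ℝ) 4, (ENNReal.ofReal (m t)) ^ 2 * ‖g t‖ₑ ^ 2 := by
    rw [← lintegral_indicator measurableSet_Ioc]
    congr 1; ext t
    by_cases ht : t ∈ Set.Ioc (-4 : ℝ) 4
    · rw [Set.indicator_of_mem ht]
    · rw [Set.indicator_of_notMem ht, hg0 t ht]; simp
  rw [hres]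
  have hpt : ∀ t ∈ Set.Ioc (-4 : ℝ) 4, (ENNReal.ofReal (m t)) ^ 2 * ‖g t‖ₑ ^ 2 ≤
      ENNReal.ofReal (1 / (a0 * c)) *
        ∫⁻ s in Set.Ioc (-4 : ℝ) 4, ENNReal.ofReal (m t) * e t s * ‖k s‖ₑ ^ 2 := by
    intro t ht
    calc (ENNReal.ofReal (m t)) ^ 2 * ‖g t‖ₑ ^ 2
        ≤ (ENNReal.ofReal (m t)) ^ 2 * ((∫⁻ s in Set.Ioc (-4 : ℝ) 4, e t s) *
          ∫⁻ s in Set.Ioc (-4 : ℝ) 4, e t s * ‖k s‖ₑ ^ 2) := by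
          gcongr
          exact (pow_le_pow_left' (duh t ht) 2).trans
            (cs_lintegral _ _ _ (he1 t).aemeasurable hkm.enorm.aemeasurable)
      _ = (ENNReal.ofReal (m t) * ∫⁻ s in Set.Ioc (-4 : ℝ) 4, e t s) * (ENNReal.ofReal (m t) *
          ∫⁻ s in Set.Ioc (-4 : ℝ) 4, e t s * ‖k s‖ₑ ^ 2) := by ring
      _ ≤ _ := by
          rw [← lintegral_const_mul _ (show Measurable fun s => e t s * ‖k s‖ₑ ^ 2 from
            (he1 t).mul (hkm.enorm.pow_const 2))]
          simp_rw [← mul_assoc (ENNReal.ofReal (m t))]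
          gcongr
          exact k1 t ht
  have hjm : Measurable (fun p : ℝ × ℝ => ENNReal.ofReal (m p.1) * e p.1 p.2 * ‖k p.2‖ₑ ^ 2) :=
    ((hmm.comp measurable_fst).ennreal_ofReal.mul hem).mul
      ((hkm.comp measurable_snd).enorm.pow_const 2)
  calc _ ≤ _ := setLIntegral_mono' measurableSet_Ioc hpt
    _ = ENNReal.ofReal (1 / (a0 * c)) * ∫⁻ s in Set.Ioc (-4 : ℝ) 4, ∫⁻ t in Set.Ioc (-4 : ℝ) 4,
          ENNReal.ofReal (m t) * e t s * ‖k s‖ₑ ^ 2 := by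
        rw [lintegral_const_mul _ hjm.lintegral_prod_right', lintegral_lintegral_swap]
        exact hjm.aemeasurable
    _ ≤ ENNReal.ofReal (1 / (a0 * c)) * ∫⁻ s in Set.Ioc (-4 : ℝ) 4,
          ENNReal.ofReal (1 / a0) * ‖k s‖ₑ ^ 2 := by
        gcongr ENNReal.ofReal (1 / (a0 * c)) * ?_
        apply setLIntegral_mono' measurableSet_Ioc
        intro s hs
        rw [lintegral_mul_const _ (show Measurable fun t => ENNReal.ofReal (m t) * e t s from
          hmm.ennreal_ofReal.mul (he2 s))]
        gcongr
        exact k2 s hs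
    _ ≤ ENNReal.ofReal (1 / (a0 * c)) * ∫⁻ s, ENNReal.ofReal (1 / a0) * ‖k s‖ₑ ^ 2 := by
        gcongr
        exact Measure.restrict_le_self
    _ = _ := by
        rw [lintegral_const_mul _ (hkm.enorm.pow_const 2), ← mul_assoc,
          ← ENNReal.ofReal_mul (by positivity)]
        congr 2
        field_simp
end P2
end KinMax

namespace KinMax
section P3
set_option linter.unusedSectionVars false
open scoped FourierTransform SchwartzMap InnerProductSpace

variable {V : Type*} [NormedAddCommGroup V] [InnerProductSpace ℝ V] [FiniteDimensional ℝ V]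
  [MeasurableSpace V] [BorelSpace V]

/-- time slice of a Schwartz function -/
def slice (U : 𝓢(ℝ × V, ℂ)) (t : ℝ) : 𝓢(V, ℂ) :=
  SchwartzMap.compCLMOfAntilipschitz (g := fun q : V => (t, q)) (K := 1) ℂ
    (by
      have h : (fun q : V => (t, q)) = fun q => ((t, 0) : ℝ × V) +
          ContinuousLinearMap.inr ℝ ℝ V q := by
        ext q <;> simp
      rw [h]
      exact (Function.HasTemperateGrowth.const _).add
        (ContinuousLinearMap.hasTemperateGrowth _))
    (fun _ _ => by simp [Prod.edist_eq]) U

lemma slice_apply (U : 𝓢(ℝ × V, ℂ)) (t : ℝ) (q : V) : slice U t q = U (t, q) := rfl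

/-- the integrable weight -/
def japa (s : V) : ℝ := (1 + ‖s‖) ^ (-((Module.finrank ℝ V + 1 : ℕ) : ℝ))

lemma japa_integrable : Integrable (japa : V → ℝ) := by
  apply integrable_one_add_norm
  push_cast; linarith

lemma schwartz_japa (U : 𝓢(ℝ × V, ℂ)) : ∃ K : ℝ, 0 ≤ K ∧ ∀ (L : ℝ) (q : V) (x : ℝ × V), 1 ≤ L →
    ‖q‖ ≤ L * ‖x.2‖ → ‖U x‖ ≤ K * L ^ (Module.finrank ℝ V + 1) * japa q := by
  set D := Module.finrank ℝ V + 1 with hD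
  let K := 2 ^ D * (Finset.Iic (D, 0)).sup (fun m => SchwartzMap.seminorm ℝ m.1 m.2) U
  have hK : ∀ x, (1 + ‖x‖) ^ D * ‖U x‖ ≤ K := by
    intro x
    have := SchwartzMap.one_add_le_sup_seminorm_apply (𝕜 := ℝ) (m := (D, 0)) (k := D) (n := 0)
      le_rfl le_rfl U x
    simpa using this
  have hK0 : 0 ≤ K := le_trans (by positivity) (hK 0)
  refine ⟨K, hK0, fun L q x hL hq => ?_⟩
  have h1 : 1 + ‖q‖ ≤ L * (1 + ‖x‖) := by
    have : ‖x.2‖ ≤ ‖x‖ := norm_snd_le x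
    nlinarith
  have h2 : (1 + ‖q‖) ^ D ≤ L ^ D * (1 + ‖x‖) ^ D := by
    rw [← mul_pow]; gcongr
  have h3 : japa q = ((1 + ‖q‖) ^ D)⁻¹ := by
    rw [japa, Real.rpow_neg (by positivity), Real.rpow_natCast]
  rw [h3, ← div_eq_mul_inv, le_div_iff₀ (by positivity)]
  calc ‖U x‖ * (1 + ‖q‖) ^ D ≤ ‖U x‖ * (L ^ D * (1 + ‖x‖) ^ D) := by gcongr
    _ = L ^ D * ((1 + ‖x‖) ^ D * ‖U x‖) := by ring
    _ ≤ L ^ D * K := by gcongr; exact hK x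
    _ = _ := by ring

lemma schwartz_bdd (ψ : 𝓢(V, ℂ)) : ∃ K : ℝ, 0 ≤ K ∧ ∀ s, ‖ψ s‖ ≤ K := by
  obtain ⟨C, h, h'⟩ := ψ.decay 0 0
  exact ⟨C, h.le, by simpa using h'⟩

lemma T_continuous (ψ : 𝓢(V, ℂ)) (U : 𝓢(ℝ × V, ℂ)) :
    Continuous fun x : ℝ × V × V => T ψ (slice U x.1) x.2.1 x.2.2 := by
  simp_rw [T_eq, slice_apply]
  obtain ⟨K, hK0, hK⟩ := schwartz_japa U
  obtain ⟨B, hB0, hB⟩ := schwartz_bdd ψ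
  apply continuous_of_dominated (bound := fun s => B * (K * 1 ^ (Module.finrank ℝ V + 1) * japa s))
  · intro x
    apply Continuous.aestronglyMeasurable
    fun_prop
  · intro x
    refine Filter.Eventually.of_forall fun s => ?_
    rw [Circle.norm_smul, norm_mul]
    gcongr
    · exact hB _
    · exact hK 1 s (x.1, s) le_rfl (by simp)
  · exact (japa_integrable.const_mul _).const_mul _
  · refine Filter.Eventually.of_forall fun s => ?_
    fun_prop

variable (N : V →L[ℝ] V)

/-- the free flow -/
def flow (t : ℝ) (q : V) : V := q + t • N q

lemma flow_continuous : Continuous fun x : ℝ × V => flow N x.1 x.2 := by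
  unfold flow; fun_prop

variable {N}

lemma flow_inv (hN : ∀ q, N (N q) = 0) (t : ℝ) (q : V) : flow N t (flow N (-t) q) = q := by
  simp [flow, hN]

lemma flow_neg_flow (hN : ∀ q, N (N q) = 0) (t : ℝ) (q : V) : flow N (-t) (flow N t q) = q := by
  simp [flow, hN]

lemma N_flow (hN : ∀ q, N (N q) = 0) (t : ℝ) (q : V) : N (flow N t q) = N q := by
  simp [flow, hN]

/-- flow as a homeomorphism -/
def flowHomeo (hN : ∀ q, N (N q) = 0) (t : ℝ) : V ≃ₜ V where
  toFun := flow N t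
  invFun := flow N (-t)
  left_inv := flow_neg_flow hN t
  right_inv := flow_inv hN t
  continuous_toFun := (flow_continuous N).comp (Continuous.prodMk_right t)
  continuous_invFun := (flow_continuous N).comp (Continuous.prodMk_right (-t))

lemma flow_inner {N' : V →L[ℝ] V} (hN : ∀ q, N (N q) = 0) (hA : ∀ x y, ⟪N x, y⟫_ℝ = ⟪x, N' y⟫_ℝ)
    (t : ℝ) (q ζ : V) : ⟪flow N t q, flow N' (-t) ζ⟫_ℝ = ⟪q, ζ⟫_ℝ := by
  simp only [flow, inner_add_left, inner_add_right, real_inner_smul_left, real_inner_smul_right,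
    ← hA, map_smul, hN, smul_zero, inner_zero_left]
  ring

lemma flow_norm_le (hN : ∀ q, N (N q) = 0) (t R : ℝ) (ht : |t| ≤ R) (q : V) :
    ‖q‖ ≤ (1 + R * ‖N‖) * ‖flow N t q‖ := by
  conv_lhs => rw [← flow_neg_flow hN t q]
  rw [flow]
  calc _ ≤ ‖flow N t q‖ + ‖(-t) • N (flow N t q)‖ := norm_add_le _ _
    _ ≤ ‖flow N t q‖ + R * (‖N‖ * ‖flow N t q‖) := by
      rw [norm_smul, norm_neg, Real.norm_eq_abs]
      have hR : 0 ≤ R := (abs_nonneg t).trans ht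
      gcongr
      exact N.le_opNorm _
    _ = _ := by ring

lemma T_flow {N' : V →L[ℝ] V} (hN : ∀ q, N (N q) = 0) (hA : ∀ x y, ⟪N x, y⟫_ℝ = ⟪x, N' y⟫_ℝ)
    (hS : ∀ t, MeasurePreserving (flow N t)) (ψ : 𝓢(V, ℂ)) (f : V → ℂ) (t : ℝ) (p ζ : V) :
    T ψ f (flow N t p) (flow N' (-t) ζ) =
      ∫ q, Real.fourierChar (-⟪q, ζ⟫_ℝ) • (ψ (flow N t (q - p)) * f (flow N t q)) := by
  rw [T_eq]
  rw [← (hS t).integral_comp (flowHomeo hN t).measurableEmbedding]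
  congr 1; ext q
  rw [flow_inner hN hA]
  have : flow N t q - flow N t p = flow N t (q - p) := by
    simp only [flow, map_sub, smul_sub]; abel
  rw [this]

lemma T_hasDerivAt {N' : V →L[ℝ] V} (hN : ∀ q, N (N q) = 0)
    (hA : ∀ x y, ⟪N x, y⟫_ℝ = ⟪x, N' y⟫_ℝ)
    (hS : ∀ t, MeasurePreserving (flow N t)) (ψ κ : 𝓢(V, ℂ)) (hκ : ∀ r, κ r = fderiv ℝ ψ r (N r))
    (u X : 𝓢(ℝ × V, ℂ)) (hX : ∀ t q, X (t, q) = fderiv ℝ u (t, q) (1, N q)) (t : ℝ) (p ζ : V) :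
    HasDerivAt (fun t => T ψ (slice u t) (flow N t p) (flow N' (-t) ζ))
      (T κ (slice u t) (flow N t p) (flow N' (-t) ζ)
        + T ψ (slice X t) (flow N t p) (flow N' (-t) ζ)) t := by
  simp_rw [T_flow hN hA hS, slice_apply]
  obtain ⟨K, hK0, hK⟩ := schwartz_japa u
  obtain ⟨K', hK0', hK'⟩ := schwartz_japa X
  obtain ⟨B, hB0, hB⟩ := schwartz_bdd ψ
  obtain ⟨B', hB0', hB'⟩ := schwartz_bdd κ
  set L := 1 + (|t| + 1) * ‖N‖ with hLdef
  have hL : 1 ≤ L := by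
    have : 0 ≤ (|t| + 1) * ‖N‖ := by positivity
    linarith
  have hfl : ∀ x ∈ Metric.ball t 1, ∀ q, ‖q‖ ≤ L * ‖flow N x q‖ := by
    intro x hx q
    apply flow_norm_le hN
    have h1 : |x - t| < 1 := hx
    have := abs_sub_abs_le_abs_sub x t
    linarith
  set D := Module.finrank ℝ V + 1
  have cf : ∀ x, Continuous fun q : V => flow N x q := fun x => by unfold flow; fun_prop
  have cf' : ∀ x, Continuous fun q : V => flow N x (q - p) := fun x => by unfold flow; fun_prop
  have cterm : ∀ (φ : 𝓢(V, ℂ)) (U : 𝓢(ℝ × V, ℂ)) (x : ℝ), Continuous fun q : V =>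
      Real.fourierChar (-⟪q, ζ⟫_ℝ) • (φ (flow N x (q - p)) * U (x, flow N x q)) := by
    intro φ U x
    have h1 : Continuous fun q => φ (flow N x (q - p)) := φ.continuous.comp (cf' x)
    have h2 : Continuous fun q => U (x, flow N x q) :=
      U.continuous.comp (continuous_const.prodMk (cf x))
    fun_prop
  have bterm : ∀ (φ : 𝓢(V, ℂ)) (U : 𝓢(ℝ × V, ℂ)) (B K : ℝ), 0 ≤ B → (∀ s, ‖φ s‖ ≤ B) →
      (∀ (L : ℝ) (q : V) (x : ℝ × V), 1 ≤ L →
        ‖q‖ ≤ L * ‖x.2‖ → ‖U x‖ ≤ K * L ^ D * japa q) → ∀ x ∈ Metric.ball t 1, ∀ q,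
      ‖Real.fourierChar (-⟪q, ζ⟫_ℝ) • (φ (flow N x (q - p)) * U (x, flow N x q))‖ ≤
        B * (K * L ^ D * japa q) := by
    intro φ U B K hB0 hB hK x hx q
    rw [Circle.norm_smul, norm_mul]
    gcongr
    · exact hB _
    · exact hK L q (x, flow N x q) hL (hfl x hx q)
  have iterm : ∀ (φ : 𝓢(V, ℂ)) (U : 𝓢(ℝ × V, ℂ)) (B K : ℝ), 0 ≤ B → (∀ s, ‖φ s‖ ≤ B) →
      (∀ (L : ℝ) (q : V) (x : ℝ × V), 1 ≤ L →
        ‖q‖ ≤ L * ‖x.2‖ → ‖U x‖ ≤ K * L ^ D * japa q) → Integrable fun q : V =>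
      Real.fourierChar (-⟪q, ζ⟫_ℝ) • (φ (flow N t (q - p)) * U (t, flow N t q)) := by
    intro φ U B K hB0 hB hK
    refine Integrable.mono' (g := fun q => B * (K * L ^ D * japa q))
      ((japa_integrable.const_mul _).const_mul _)
      (cterm φ U t).aestronglyMeasurable (Filter.Eventually.of_forall fun q => ?_)
    exact bterm φ U B K hB0 hB hK t (Metric.mem_ball_self one_pos) q
  have main := hasDerivAt_integral_of_dominated_loc_of_deriv_le (μ := (volume : Measure V))
    (s := Metric.ball t 1) (x₀ := t)
    (F := fun x q => Real.fourierChar (-⟪q, ζ⟫_ℝ) • (ψ (flow N x (q - p)) * u (x, flow N x q)))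
    (F' := fun x q => Real.fourierChar (-⟪q, ζ⟫_ℝ) • (κ (flow N x (q - p)) * u (x, flow N x q))
      + Real.fourierChar (-⟪q, ζ⟫_ℝ) • (ψ (flow N x (q - p)) * X (x, flow N x q)))
    (bound := fun q => B' * (K * L ^ D * japa q) + B * (K' * L ^ D * japa q))
    (Metric.ball_mem_nhds t one_pos)
    (Filter.Eventually.of_forall fun x => (cterm ψ u x).aestronglyMeasurable)
    (iterm ψ u B K hB0 hB hK)
    ((cterm κ u t).add (cterm ψ X t)).aestronglyMeasurable
    (Filter.Eventually.of_forall fun q x hx => (norm_add_le _ _).trans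
      (add_le_add (bterm κ u B' K hB0' hB' hK x hx q) (bterm ψ X B K' hB0 hB hK' x hx q)))
    (((japa_integrable.const_mul _).const_mul _).add ((japa_integrable.const_mul _).const_mul _))
    (Filter.Eventually.of_forall fun q x _ => by
      have hf : ∀ r : V, HasDerivAt (fun x => flow N x r) (N r) x := by
        intro r
        have := ((hasDerivAt_id x).smul_const (N r)).const_add r
        simpa [flow] using this
      have h1 : HasDerivAt (fun x => ψ (flow N x (q - p))) (κ (flow N x (q - p))) x := by
        rw [hκ, N_flow hN]
        exact (ψ.differentiableAt.hasFDerivAt).comp_hasDerivAt x (hf (q - p))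
      have h2 : HasDerivAt (fun x => u (x, flow N x q)) (X (x, flow N x q)) x := by
        rw [hX, N_flow hN]
        exact (u.differentiableAt.hasFDerivAt).comp_hasDerivAt x
          ((hasDerivAt_id x).prodMk (hf q))
      have h3 := (h1.mul h2).const_smul (Real.fourierChar (-⟪q, ζ⟫_ℝ))
      rw [smul_add] at h3
      exact h3)
  rw [← integral_add (iterm κ u B' K hB0' hB' hK) (iterm ψ X B K' hB0 hB hK')]
  exact main.2

end P3
end KinMax

namespace KinMax
section P4
set_option linter.unusedSectionVars false
open scoped FourierTransform SchwartzMap InnerProductSpace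

variable {V : Type*} [NormedAddCommGroup V] [InnerProductSpace ℝ V] [FiniteDimensional ℝ V]
  [MeasurableSpace V] [BorelSpace V] {N : V →L[ℝ] V}

lemma cov {N' : V →L[ℝ] V} (hS : ∀ t, MeasurePreserving (flow N t))
    (hS' : ∀ t, MeasurePreserving (flow N' t)) (Φ : ℝ × V × V → ℝ≥0∞) (hΦ : Measurable Φ) :
    ∫⁻ p, ∫⁻ ζ, ∫⁻ t, Φ (t, flow N t p, flow N' (-t) ζ) = ∫⁻ t, ∫⁻ q, ∫⁻ ζ, Φ (t, q, ζ) := by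
  have hfl : Measurable fun x : ℝ × V => flow N x.1 x.2 := (flow_continuous N).measurable
  have hfl' : Measurable fun x : ℝ × V => flow N' (-x.1) x.2 :=
    (flow_continuous N').measurable.comp ((measurable_fst.neg).prodMk measurable_snd)
  have hj : Measurable fun x : V × V × ℝ => Φ (x.2.2, flow N x.2.2 x.1, flow N' (-x.2.2) x.2.1) := by
    apply hΦ.comp
    refine (measurable_snd.comp measurable_snd).prodMk (Measurable.prodMk ?_ ?_)
    · exact hfl.comp ((measurable_snd.comp measurable_snd).prodMk measurable_fst)
    · exact hfl'.comp ((measurable_snd.comp measurable_snd).prodMk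
        (measurable_fst.comp measurable_snd))
  have h1 : ∀ p, ∫⁻ ζ, ∫⁻ t, Φ (t, flow N t p, flow N' (-t) ζ)
      = ∫⁻ t, ∫⁻ ζ, Φ (t, flow N t p, flow N' (-t) ζ) := by
    intro p
    rw [lintegral_lintegral_swap]
    exact (hj.comp (measurable_const.prodMk measurable_id : Measurable fun x : V × ℝ => (p, x))).aemeasurable
  simp_rw [h1]
  rw [lintegral_lintegral_swap]
  · congr 1; ext t
    have h2 : ∀ q, ∫⁻ ζ, Φ (t, q, flow N' (-t) ζ) = ∫⁻ ζ, Φ (t, q, ζ) := by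
      intro q
      exact (hS' (-t)).lintegral_comp (f := fun ζ => Φ (t, q, ζ)) (by fun_prop)
    simp_rw [h2]
    have h3 : Measurable fun q => ∫⁻ ζ, Φ (t, q, ζ) := by
      apply Measurable.lintegral_prod_right' (f := fun x : V × V => Φ (t, x.1, x.2))
      fun_prop
    exact (hS t).lintegral_comp h3
  · apply Measurable.aemeasurable
    apply Measurable.lintegral_prod_right'
      (f := fun x : (V × ℝ) × V => Φ (x.1.2, flow N x.1.2 x.1.1, flow N' (-x.1.2) x.2))
    exact hj.comp (((measurable_fst.comp measurable_fst).prodMk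
      (measurable_snd.prodMk (measurable_snd.comp measurable_fst))))

/-- the derivative along a temperate vector field -/
def dirD {W : Type*} [NormedAddCommGroup W] [NormedSpace ℝ W] (g : W → W)
    (hg : g.HasTemperateGrowth) (ψ : 𝓢(W, ℂ)) : 𝓢(W, ℂ) :=
  SchwartzMap.bilinLeftCLM (ContinuousLinearMap.id ℝ (W →L[ℝ] ℂ)) hg (SchwartzMap.fderivCLM ℝ W ℂ ψ)

lemma dirD_apply {W : Type*} [NormedAddCommGroup W] [NormedSpace ℝ W] (g : W → W)
    (hg : g.HasTemperateGrowth) (ψ : 𝓢(W, ℂ)) (r : W) : dirD g hg ψ r = fderiv ℝ ψ r (g r) := rfl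

lemma exists_window (N : V →L[ℝ] V) (δ : ℝ) (hδ : 0 < δ) : ∃ ψ κ : 𝓢(V, ℂ),
    (∀ r, κ r = fderiv ℝ ψ r (N r)) ∧ (∀ r, ψ r ≠ 0 → ‖r‖ ≤ δ) ∧ N2 ψ ≠ 0 := by
  let b : ContDiffBump (0 : V) := ⟨δ / 2, δ, by positivity, by linarith⟩
  have hb : ContDiff ℝ ((⊤ : ℕ∞) : WithTop ℕ∞) (fun r : V => ((b r : ℝ) : ℂ)) :=
    Complex.ofRealCLM.contDiff.comp b.contDiff
  have hs : HasCompactSupport (fun r : V => ((b r : ℝ) : ℂ)) :=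
    b.hasCompactSupport.comp_left (g := Complex.ofReal) (by simp)
  let ψ : 𝓢(V, ℂ) := hs.toSchwartzMap hb
  have hψ : ∀ r, ψ r = (b r : ℂ) := fun r => rfl
  refine ⟨ψ, dirD N N.hasTemperateGrowth ψ, fun r => dirD_apply _ _ _ _, ?_, ?_⟩
  · intro r hr
    rw [hψ] at hr
    have : r ∈ Function.support b := by simpa using hr
    rw [b.support_eq] at this
    exact (by simpa using this : ‖r‖ < δ).le
  · intro h
    rw [N2, lintegral_eq_zero_iff (ψ.continuous.measurable.enorm.pow_const 2)] at h
    have h2 : (fun r => ψ r) =ᵐ[volume] fun _ => (0 : ℂ) := by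
      filter_upwards [h] with r hr
      simpa using hr
    have h3 := (Continuous.ae_eq_iff_eq volume ψ.continuous continuous_const).1 h2
    have h4 := congrFun h3 0
    simp only [hψ] at h4
    have h5 : b 0 = 1 := b.one_of_mem_closedBall (by simp [b]; positivity)
    rw [h5] at h4
    simp at h4

/-- transport of the ODE estimate to phase space -/
lemma phase_est {N' : V →L[ℝ] V} (hN : ∀ q, N (N q) = 0)
    (hA : ∀ x y, ⟪N x, y⟫_ℝ = ⟪x, N' y⟫_ℝ)
    (hS : ∀ t, MeasurePreserving (flow N t)) (hS' : ∀ t, MeasurePreserving (flow N' t))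
    (m : V → ℝ) (hm : Continuous m) (hm0 : ∀ ζ, 0 ≤ m ζ) (c : ℝ) (hc : 0 < c)
    (M1 : ∀ ζ s t, s ≤ t → c * (t - s) * m (flow N' (-t) ζ) ≤ ∫ r in s..t, m (flow N' (-r) ζ))
    (a0 : ℝ) (ha0 : 0 < a0)
    (ψ κ : 𝓢(V, ℂ)) (hκ : ∀ r, κ r = fderiv ℝ ψ r (N r))
    (a : ℝ × V → ℝ) (ha : Continuous a) (hal : ∀ x, a0 ≤ a x)
    (u X : 𝓢(ℝ × V, ℂ)) (hX : ∀ t q, X (t, q) = fderiv ℝ u (t, q) (1, N q))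
    (hu : ∀ t q, t ∉ Set.Ioc (-4 : ℝ) 4 → u (t, q) = 0) :
    ∫⁻ t, ∫⁻ q, ∫⁻ ζ, (ENNReal.ofReal (m ζ)) ^ 2 * ‖T ψ (slice u t) q ζ‖ₑ ^ 2
      ≤ ENNReal.ofReal (1 / (a0 ^ 2 * c)) * ∫⁻ t, ∫⁻ q, ∫⁻ ζ,
        ‖T κ (slice u t) q ζ + T ψ (slice X t) q ζ
          + a (t, q) * m ζ * T ψ (slice u t) q ζ‖ₑ ^ 2 := by
  have c1 := T_continuous ψ u
  have c2 := T_continuous κ u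
  have c3 := T_continuous ψ X
  have hKc : Continuous fun x : ℝ × V × V => T κ (slice u x.1) x.2.1 x.2.2
      + T ψ (slice X x.1) x.2.1 x.2.2
      + (a (x.1, x.2.1) : ℂ) * m x.2.2 * T ψ (slice u x.1) x.2.1 x.2.2 := by fun_prop
  have e1 := cov hS hS' (fun x => (ENNReal.ofReal (m x.2.2)) ^ 2 *
    ‖T ψ (slice u x.1) x.2.1 x.2.2‖ₑ ^ 2)
    (((hm.measurable.comp (by fun_prop)).ennreal_ofReal.pow_const 2).mul
      (c1.measurable.enorm.pow_const 2))
  have e2 := cov hS hS' (fun x => ‖T κ (slice u x.1) x.2.1 x.2.2 + T ψ (slice X x.1) x.2.1 x.2.2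
          + a (x.1, x.2.1) * m x.2.2 * T ψ (slice u x.1) x.2.1 x.2.2‖ₑ ^ 2)
      (hKc.measurable.enorm.pow_const 2)
  simp only at e1 e2
  rw [← e1, ← e2]
  have hj : Continuous fun x : (V × V) × ℝ =>
      (x.2, flow N x.2 x.1.1, flow N' (-x.2) x.1.2) := by
    unfold flow; fun_prop
  rw [← lintegral_const_mul' _ _ ENNReal.ofReal_ne_top]
  refine lintegral_mono fun p => ?_
  rw [← lintegral_const_mul' _ _ ENNReal.ofReal_ne_top]
  refine lintegral_mono fun ζ => ?_
  have hjt : Continuous fun t : ℝ => (t, flow N t p, flow N' (-t) ζ) :=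
    hj.comp (Continuous.prodMk_right (p, ζ))
  have k1 : Continuous fun t => T ψ (slice u t) (flow N t p) (flow N' (-t) ζ) := by
    simpa only [Function.comp_def] using c1.comp hjt
  have k2 : Continuous fun t => T κ (slice u t) (flow N t p) (flow N' (-t) ζ) := by
    simpa only [Function.comp_def] using c2.comp hjt
  have k3 : Continuous fun t => T ψ (slice X t) (flow N t p) (flow N' (-t) ζ) := by
    simpa only [Function.comp_def] using c3.comp hjt
  have k4 : Continuous fun t => a (t, flow N t p) :=
    ha.comp ((continuous_fst.prodMk (continuous_fst.comp continuous_snd)).comp hjt)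
  have k5 : Continuous fun t => m (flow N' (-t) ζ) :=
    hm.comp ((continuous_snd.comp continuous_snd).comp hjt)
  refine ode_lemma (fun t => T ψ (slice u t) (flow N t p) (flow N' (-t) ζ))
    (fun t => T κ (slice u t) (flow N t p) (flow N' (-t) ζ)
        + T ψ (slice X t) (flow N t p) (flow N' (-t) ζ)
        + a (t, flow N t p) * m (flow N' (-t) ζ) * T ψ (slice u t) (flow N t p) (flow N' (-t) ζ))
    (fun t => a (t, flow N t p)) (fun t => m (flow N' (-t) ζ)) a0 c ha0 hc
    ((k2.add k3).add (((Complex.continuous_ofReal.comp k4).mul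
      (Complex.continuous_ofReal.comp k5)).mul k1)) k4 k5 (fun t => hm0 _) (fun t => hal _) ?_ ?_ ?_
  · intro t
    exact (T_hasDerivAt hN hA hS ψ κ hκ u X hX t p ζ).congr_deriv (by ring)
  · intro t ht
    rw [T_eq]
    simp [slice_apply, hu t _ ht]
  · exact fun s t hst => M1 ζ s t hst

end P4
end KinMax

namespace KinMax
section P5
set_option linter.unusedSectionVars false
open scoped FourierTransform SchwartzMap InnerProductSpace

variable {V : Type*} [NormedAddCommGroup V] [InnerProductSpace ℝ V] [FiniteDimensional ℝ V]
  [MeasurableSpace V] [BorelSpace V] {N : V →L[ℝ] V}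

lemma T_cont_slice (ψ : 𝓢(V, ℂ)) (U : 𝓢(ℝ × V, ℂ)) (t : ℝ) :
    Continuous fun x : V × V => T ψ (slice U t) x.1 x.2 := by
  simpa only [Function.comp_def] using
    (T_continuous ψ U).comp (Continuous.prodMk_right t : Continuous fun x : V × V => (t, x))

lemma local_est (ψ : 𝓢(V, ℂ)) (δ : ℝ) (hψ : ∀ r, ψ r ≠ 0 → ‖r‖ ≤ δ)
    (a : V → ℝ) (ha : Continuous a) (Lip : ℝ) (hLip0 : 0 ≤ Lip)
    (hLip : ∀ q s, |a q - a s| ≤ Lip * ‖q - s‖) (x l : 𝓢(V, ℂ)) :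
    ∫⁻ q, ∫⁻ ζ, ‖T ψ x q ζ + a q * T ψ l q ζ‖ₑ ^ 2 ≤
      2 * N2 ψ * (N2 (fun s => x s + a s * l s) + ENNReal.ofReal ((Lip * δ) ^ 2) * N2 l) := by
  have h1 : ∀ q, ∫⁻ ζ, ‖T ψ x q ζ + a q * T ψ l q ζ‖ₑ ^ 2 ≤ ∫⁻ s, ‖ψ (s - q)‖ₑ ^ 2 *
      (2 * ‖x s + a s * l s‖ₑ ^ 2 + 2 * (ENNReal.ofReal ((Lip * δ) ^ 2) * ‖l s‖ₑ ^ 2)) := by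
    intro q
    have e := T_plancherel ψ (x + (a q : ℂ) • l) q
    have e' : (⇑(x + (a q : ℂ) • l) : V → ℂ) = fun s => x s + (a q : ℂ) * l s := rfl
    rw [e'] at e
    simp_rw [T_add] at e
    rw [e]
    refine lintegral_mono fun s => ?_
    by_cases hs : ψ (s - q) = 0
    · simp [hs]
    · gcongr
      have e1 : x s + (a q : ℂ) * l s = (x s + a s * l s) + ((a q - a s : ℝ) : ℂ) * l s := by
        push_cast; ring
      rw [e1]
      refine (enorm_add_sq_le _ _).trans ?_
      gcongr
      rw [enorm_mul, mul_pow]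
      gcongr
      rw [← ofReal_norm, ← ENNReal.ofReal_pow (norm_nonneg _), Complex.norm_real,
        Real.norm_eq_abs]
      apply ENNReal.ofReal_le_ofReal
      gcongr
      refine (hLip q s).trans ?_
      gcongr
      rw [norm_sub_rev]
      exact hψ _ hs
  refine (lintegral_mono h1).trans ?_
  have hx := x.continuous.measurable
  have hl := l.continuous.measurable
  have ham := ha.measurable
  rw [weight_integral ψ _ (by fun_prop), lintegral_add_left (by fun_prop),
    lintegral_const_mul' _ _ (by simp), lintegral_const_mul' _ _ (by simp),
    lintegral_const_mul' _ _ (by simp)]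
  apply le_of_eq
  unfold N2
  ring

lemma slice_est (ψ κ : 𝓢(V, ℂ)) (δ : ℝ) (hψ : ∀ r, ψ r ≠ 0 → ‖r‖ ≤ δ)
    (a : V → ℝ) (ha : Continuous a) (A : ℝ) (hA : ∀ q, |a q| ≤ A) (Lip : ℝ) (hLip0 : 0 ≤ Lip)
    (hLip : ∀ q s, |a q - a s| ≤ Lip * ‖q - s‖) (m : V → ℝ) (hm : Continuous m)
    (u X ℓ : 𝓢(ℝ × V, ℂ)) (t : ℝ) :
    ∫⁻ q, ∫⁻ ζ, ‖T κ (slice u t) q ζ + T ψ (slice X t) q ζ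
          + a q * m ζ * T ψ (slice u t) q ζ‖ₑ ^ 2 ≤
      4 * N2 ψ * (N2 (fun s => slice X t s + a s * slice ℓ t s)
        + ENNReal.ofReal ((Lip * δ) ^ 2) * N2 (slice ℓ t)) + 4 * (N2 κ * N2 (slice u t))
      + 4 * ENNReal.ofReal (A ^ 2) *
        ∫⁻ q, ∫⁻ ζ, ‖(m ζ : ℂ) * T ψ (slice u t) q ζ - T ψ (slice ℓ t) q ζ‖ₑ ^ 2 := by
  have c1 := T_cont_slice ψ u t
  have c2 := T_cont_slice κ u t
  have c3 := T_cont_slice ψ X t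
  have c4 := T_cont_slice ψ ℓ t
  have m1 : Measurable fun x : V × V => ‖T ψ (slice X t) x.1 x.2
      + (a x.1 : ℂ) * T ψ (slice ℓ t) x.1 x.2‖ₑ ^ 2 := by
    have : Continuous fun x : V × V => T ψ (slice X t) x.1 x.2
      + (a x.1 : ℂ) * T ψ (slice ℓ t) x.1 x.2 := by fun_prop
    exact this.measurable.enorm.pow_const 2
  have m2 : Measurable fun x : V × V => ‖T κ (slice u t) x.1 x.2‖ₑ ^ 2 :=
    c2.measurable.enorm.pow_const 2
  have hpt : ∀ q ζ, ‖T κ (slice u t) q ζ + T ψ (slice X t) q ζ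
          + a q * m ζ * T ψ (slice u t) q ζ‖ₑ ^ 2 ≤
      2 * ‖T ψ (slice X t) q ζ + a q * T ψ (slice ℓ t) q ζ‖ₑ ^ 2
      + (4 * ‖T κ (slice u t) q ζ‖ₑ ^ 2 + 4 * ENNReal.ofReal (A ^ 2) *
        ‖(m ζ : ℂ) * T ψ (slice u t) q ζ - T ψ (slice ℓ t) q ζ‖ₑ ^ 2) := by
    intro q ζ
    have e : T κ (slice u t) q ζ + T ψ (slice X t) q ζ + a q * m ζ * T ψ (slice u t) q ζ
      = (T ψ (slice X t) q ζ + a q * T ψ (slice ℓ t) q ζ) + (T κ (slice u t) q ζ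
        + a q * ((m ζ : ℂ) * T ψ (slice u t) q ζ - T ψ (slice ℓ t) q ζ)) := by ring
    rw [e]
    refine (enorm_add_sq_le _ _).trans ?_
    gcongr
    calc _ ≤ 2 * (2 * ‖T κ (slice u t) q ζ‖ₑ ^ 2 + 2 *
          ‖a q * ((m ζ : ℂ) * T ψ (slice u t) q ζ - T ψ (slice ℓ t) q ζ)‖ₑ ^ 2) := by
          gcongr; exact enorm_add_sq_le _ _
      _ = 4 * ‖T κ (slice u t) q ζ‖ₑ ^ 2 + 4 * ‖(a q : ℂ)‖ₑ ^ 2 *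
          ‖(m ζ : ℂ) * T ψ (slice u t) q ζ - T ψ (slice ℓ t) q ζ‖ₑ ^ 2 := by
          rw [enorm_mul, mul_pow]; ring
      _ ≤ _ := by
          gcongr
          rw [← ofReal_norm, ← ENNReal.ofReal_pow (norm_nonneg _), Complex.norm_real,
            Real.norm_eq_abs]
          apply ENNReal.ofReal_le_ofReal
          gcongr
          exact hA q
  have hq : ∀ q, ∫⁻ ζ, ‖T κ (slice u t) q ζ + T ψ (slice X t) q ζ
          + a q * m ζ * T ψ (slice u t) q ζ‖ₑ ^ 2 ≤
      2 * (∫⁻ ζ, ‖T ψ (slice X t) q ζ + a q * T ψ (slice ℓ t) q ζ‖ₑ ^ 2)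
      + (4 * (∫⁻ ζ, ‖T κ (slice u t) q ζ‖ₑ ^ 2) + 4 * ENNReal.ofReal (A ^ 2) *
        ∫⁻ ζ, ‖(m ζ : ℂ) * T ψ (slice u t) q ζ - T ψ (slice ℓ t) q ζ‖ₑ ^ 2) := by
    intro q
    refine (lintegral_mono (hpt q)).trans ?_
    have m1' := m1.comp (measurable_prodMk_left (x := q))
    have m2' := m2.comp (measurable_prodMk_left (x := q))
    simp only [Function.comp_def] at m1' m2'
    rw [lintegral_add_left (m1'.const_mul _), lintegral_add_left (m2'.const_mul _),
      lintegral_const_mul' _ _ (by simp), lintegral_const_mul' _ _ (by simp),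
      lintegral_const_mul' _ _ (ENNReal.mul_ne_top (by simp) (by simp))]
  refine (lintegral_mono hq).trans ?_
  have m1' := m1.lintegral_prod_right' (ν := (volume : Measure V))
  have m2' := m2.lintegral_prod_right' (ν := (volume : Measure V))
  rw [lintegral_add_left (m1'.const_mul _), lintegral_add_left (m2'.const_mul _),
      lintegral_const_mul' _ _ (by simp), lintegral_const_mul' _ _ (by simp),
      lintegral_const_mul' _ _ (ENNReal.mul_ne_top (by simp) (by simp)), moyal, ← add_assoc]
  gcongr ?_ + _ + _
  calc _ ≤ 2 * (2 * N2 ψ * (N2 (fun s => slice X t s + a s * slice ℓ t s)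
        + ENNReal.ofReal ((Lip * δ) ^ 2) * N2 (slice ℓ t))) := by
        gcongr
        exact local_est ψ δ hψ a ha Lip hLip0 hLip _ _
    _ = _ := by ring

lemma lower_est (ψ : 𝓢(V, ℂ)) (m : V → ℝ) (hm : Continuous m) (hm0 : ∀ ζ, 0 ≤ m ζ)
    (u ℓ : 𝓢(ℝ × V, ℂ)) (t : ℝ) :
    N2 ψ * N2 (slice ℓ t) ≤
      2 * (∫⁻ q, ∫⁻ ζ, ‖(m ζ : ℂ) * T ψ (slice u t) q ζ - T ψ (slice ℓ t) q ζ‖ₑ ^ 2) +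
      2 * ∫⁻ q, ∫⁻ ζ, (ENNReal.ofReal (m ζ)) ^ 2 * ‖T ψ (slice u t) q ζ‖ₑ ^ 2 := by
  rw [← moyal]
  have c1 := T_cont_slice ψ u t
  have c4 := T_cont_slice ψ ℓ t
  have m1 : Measurable fun x : V × V =>
      ‖(m x.2 : ℂ) * T ψ (slice u t) x.1 x.2 - T ψ (slice ℓ t) x.1 x.2‖ₑ ^ 2 := by
    have : Continuous fun x : V × V =>
      (m x.2 : ℂ) * T ψ (slice u t) x.1 x.2 - T ψ (slice ℓ t) x.1 x.2 := by fun_prop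
    exact this.measurable.enorm.pow_const 2
  have m1' := m1.lintegral_prod_right' (ν := (volume : Measure V))
  rw [← lintegral_const_mul' _ _ (by simp), ← lintegral_const_mul' _ _ (by simp),
    ← lintegral_add_left (m1'.const_mul _)]
  refine lintegral_mono fun q => ?_
  have m2 := m1.comp (measurable_prodMk_left (x := q))
  simp only [Function.comp_def] at m2
  rw [← lintegral_const_mul' _ _ (by simp), ← lintegral_const_mul' _ _ (by simp),
    ← lintegral_add_left (m2.const_mul _)]
  refine lintegral_mono fun ζ => ?_
  have e : T ψ (slice ℓ t) q ζ = -((m ζ : ℂ) * T ψ (slice u t) q ζ - T ψ (slice ℓ t) q ζ)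
    + (m ζ : ℂ) * T ψ (slice u t) q ζ := by ring
  conv_lhs => rw [e]
  refine (enorm_add_sq_le _ _).trans ?_
  rw [enorm_neg, enorm_mul, mul_pow, ← ofReal_norm (m ζ : ℂ), Complex.norm_real,
    Real.norm_of_nonneg (hm0 ζ)]

lemma absorb (Y R b : ℝ≥0∞) (hY : Y ≠ ∞) (hb : b ≤ 1 / 2) (h : Y ≤ R + b * Y) : Y ≤ 2 * R := by
  have h1 : Y ≤ R + Y / 2 := by
    refine h.trans ?_
    gcongr
    calc b * Y ≤ (1 / 2) * Y := by gcongr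
      _ = Y / 2 := by rw [mul_comm, mul_one_div]
  have h2 : Y / 2 + Y / 2 ≤ R + Y / 2 := by rwa [ENNReal.add_halves]
  have hfin : Y / 2 ≠ ∞ := ENNReal.div_ne_top hY (by simp)
  have h3 : Y / 2 ≤ R := (ENNReal.add_le_add_iff_right hfin).1 h2
  calc Y = Y / 2 + Y / 2 := (ENNReal.add_halves Y).symm
    _ ≤ R + R := by gcongr
    _ = 2 * R := by ring

theorem core {N' : V →L[ℝ] V} (hN : ∀ q, N (N q) = 0)
    (hA : ∀ x y, ⟪N x, y⟫_ℝ = ⟪x, N' y⟫_ℝ)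
    (hS : ∀ t, MeasurePreserving (flow N t)) (hS' : ∀ t, MeasurePreserving (flow N' t))
    (m : V → ℝ) (hm : Continuous m) (hm0 : ∀ ζ, 0 ≤ m ζ) (c : ℝ) (hc : 0 < c)
    (M1 : ∀ ζ s t, s ≤ t → c * (t - s) * m (flow N' (-t) ζ) ≤ ∫ r in s..t, m (flow N' (-r) ζ))
    (M2 : ∀ ε > 0, ∃ C ≥ 0, ∀ ζ θ, |m ζ - m (ζ + θ)| ≤ ε * m (ζ + θ) + C * (1 + ‖θ‖) ^ 2)
    (a0 : ℝ) (ha0 : 0 < a0) (A Lip : ℝ) (hLip0 : 0 ≤ Lip)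
    (a : ℝ × V → ℝ) (ha : Continuous a) (hal : ∀ x, a0 ≤ a x) (haA : ∀ x, |a x| ≤ A)
    (hLip : ∀ t q s, |a (t, q) - a (t, s)| ≤ Lip * ‖q - s‖) :
    ∃ C : ℝ≥0∞, C ≠ ∞ ∧ ∀ u X ℓ : 𝓢(ℝ × V, ℂ),
      (∀ t q, X (t, q) = fderiv ℝ u (t, q) (1, N q)) →
      (∀ t q, t ∉ Set.Ioc (-4 : ℝ) 4 → u (t, q) = 0) →
      (∀ t ζ, 𝓕 (slice ℓ t) ζ = (m ζ : ℂ) * 𝓕 (slice u t) ζ) →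
      ∫⁻ t, ∫⁻ q, ‖ℓ (t, q)‖ₑ ^ 2 ≤
        C * ((∫⁻ t, ∫⁻ q, ‖X (t, q) + a (t, q) * ℓ (t, q)‖ₑ ^ 2) + ∫⁻ t, ∫⁻ q, ‖u (t, q)‖ₑ ^ 2) := by
  have hA0 : 0 ≤ A := (abs_nonneg _).trans (haA 0)
  set C1 : ℝ := 1 / (a0 ^ 2 * c) with hC1
  have hC1p : 0 ≤ C1 := by positivity
  set δ : ℝ := 1 / (1 + 32 * C1 * Lip ^ 2) with hδ
  have hδp : 0 < δ := by positivity
  set ε : ℝ := 1 / (16 + 64 * C1 * A ^ 2) with hε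
  have hεp : 0 < ε := by positivity
  obtain ⟨Cm, hCm0, hCm⟩ := M2 ε hεp
  obtain ⟨ψ, κ, hκ, hψ, hψ0⟩ := exists_window N δ hδp
  obtain ⟨K, hKt, hK⟩ := comm_bound ψ m hm hm0 ε Cm hεp.le hCm0 hCm
  set ν := N2 ψ with hν
  have hνt : ν ≠ ∞ := (N2_schwartz_lt_top ψ).ne
  have hκt : N2 κ ≠ ∞ := (N2_schwartz_lt_top κ).ne
  set c1 := ENNReal.ofReal C1 with hc1
  set lam := ENNReal.ofReal ((Lip * δ) ^ 2) with hlam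
  set A2 := ENNReal.ofReal (A ^ 2) with hA2
  set e2 := ENNReal.ofReal (2 * ε ^ 2) with he2
  have hb : 8 * c1 * lam + 8 * c1 * A2 * e2 + 2 * e2 ≤ 1 / 2 := by
    have h1 : 8 * c1 * lam + 8 * c1 * A2 * e2 + 2 * e2 = ENNReal.ofReal
        (8 * C1 * (Lip * δ) ^ 2 + 8 * C1 * A ^ 2 * (2 * ε ^ 2) + 2 * (2 * ε ^ 2)) := by
      rw [ENNReal.ofReal_add (by positivity) (by positivity),
        ENNReal.ofReal_add (by positivity) (by positivity),
        ENNReal.ofReal_mul (by positivity), ENNReal.ofReal_mul (by positivity),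
        ENNReal.ofReal_mul (by positivity), ENNReal.ofReal_mul (by positivity),
        ENNReal.ofReal_mul (p := 2) (by positivity)]
      simp [c1, lam, A2, e2]
    have h2 : (1 / 2 : ℝ≥0∞) = ENNReal.ofReal (1 / 2) := by
      rw [ENNReal.ofReal_div_of_pos (by norm_num)]; simp
    rw [h1, h2]
    apply ENNReal.ofReal_le_ofReal
    have hd1 : δ * (1 + 32 * C1 * Lip ^ 2) = 1 := by rw [hδ]; field_simp
    have he1 : ε * (16 + 64 * C1 * A ^ 2) = 1 := by rw [hε]; field_simp
    have hx : 0 ≤ C1 * Lip ^ 2 := by positivity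
    have hy : 0 ≤ C1 * A ^ 2 := by positivity
    have hδ1 : δ ≤ 1 := by nlinarith
    have hε1 : ε ≤ 1 := by nlinarith
    have i1 : 8 * C1 * (Lip * δ) ^ 2 ≤ 1 / 4 := by
      calc 8 * C1 * (Lip * δ) ^ 2 = 8 * (C1 * Lip ^ 2) * δ * δ := by ring
        _ ≤ 8 * (C1 * Lip ^ 2) * δ * 1 := by gcongr
        _ ≤ 1 / 4 := by nlinarith
    have i2 : 8 * C1 * A ^ 2 * (2 * ε ^ 2) + 2 * (2 * ε ^ 2) ≤ 1 / 4 := by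
      calc 8 * C1 * A ^ 2 * (2 * ε ^ 2) + 2 * (2 * ε ^ 2)
          = (16 * (C1 * A ^ 2) + 4) * ε * ε := by ring
        _ ≤ (16 * (C1 * A ^ 2) + 4) * ε * 1 := by gcongr
        _ ≤ 1 / 4 := by nlinarith
    linarith
  set B : ℝ≥0∞ := 8 * c1 * (N2 κ + A2 * K) + 2 * K with hB
  have hBt : B ≠ ∞ := by
    simp only [hB]
    finiteness
  refine ⟨ν⁻¹ * (2 * (8 * c1 * ν + B)), ?_, ?_⟩
  · have : ν⁻¹ ≠ ∞ := ENNReal.inv_ne_top.2 hψ0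
    simp only [hc1]
    finiteness
  intro u X ℓ hX hu hℓ
  set L := ∫⁻ t, ∫⁻ q, ‖ℓ (t, q)‖ₑ ^ 2 with hLdef
  set Pn := ∫⁻ t, ∫⁻ q, ‖X (t, q) + a (t, q) * ℓ (t, q)‖ₑ ^ 2 with hPdef
  set U := ∫⁻ t, ∫⁻ q, ‖u (t, q)‖ₑ ^ 2 with hUdef
  have hLt : L ≠ ∞ := by
    have h1 : L = ∫⁻ x : ℝ × V, ‖ℓ x‖ₑ ^ 2 :=
      (lintegral_prod _ (ℓ.continuous.measurable.enorm.pow_const 2).aemeasurable).symm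
    rw [h1]
    haveI : (volume : Measure (ℝ × V)).IsAddHaarMeasure := by
      rw [Measure.volume_eq_prod]; infer_instance
    have h2 := N2_eq_integral ℓ (schwartz_sq_integrable (volume : Measure (ℝ × V)) ℓ)
    unfold N2 at h2
    rw [h2]; exact ENNReal.ofReal_ne_top
  set Dt : ℝ → ℝ≥0∞ := fun t =>
    ∫⁻ q, ∫⁻ ζ, ‖(m ζ : ℂ) * T ψ (slice u t) q ζ - T ψ (slice ℓ t) q ζ‖ₑ ^ 2 with hDt
  have hD : ∀ t, Dt t ≤ e2 * (ν * N2 (slice ℓ t)) + K * N2 (slice u t) := by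
    intro t
    refine le_trans (le_of_eq ?_) (hK (slice u t) (slice ℓ t) (hℓ t))
    simp only [hDt]
    rw [lintegral_lintegral_swap]
    have k1 := T_cont_slice ψ u t
    have k4 := T_cont_slice ψ ℓ t
    have : Continuous fun x : V × V =>
      (m x.2 : ℂ) * T ψ (slice u t) x.1 x.2 - T ψ (slice ℓ t) x.1 x.2 := by fun_prop
    exact (this.measurable.enorm.pow_const 2).aemeasurable
  have mP : Measurable fun t => N2 (fun s => slice X t s + a (t, s) * slice ℓ t s) := by
    apply Measurable.lintegral_prod_right'
      (f := fun x : ℝ × V => ‖X x + a x * ℓ x‖ₑ ^ 2)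
    have : Continuous fun x : ℝ × V => X x + a x * ℓ x := by fun_prop
    exact this.measurable.enorm.pow_const 2
  have mS : ∀ W : 𝓢(ℝ × V, ℂ), Measurable fun t => N2 (slice W t) := by
    intro W
    apply Measurable.lintegral_prod_right' (f := fun x : ℝ × V => ‖W x‖ₑ ^ 2)
    exact W.continuous.measurable.enorm.pow_const 2
  set Mn := ∫⁻ t, ∫⁻ q, ∫⁻ ζ, (ENNReal.ofReal (m ζ)) ^ 2 * ‖T ψ (slice u t) q ζ‖ₑ ^ 2 with hMn
  have hMn1 : Mn ≤ c1 * (4 * ν * Pn + (4 * ν * lam + 4 * A2 * (e2 * ν)) * L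
      + (4 * N2 κ + 4 * A2 * K) * U) := by
    refine (phase_est hN hA hS hS' m hm hm0 c hc M1 a0 ha0 ψ κ hκ a ha hal u X hX hu).trans ?_
    gcongr c1 * ?_
    calc _ ≤ ∫⁻ t, ((4 * ν * N2 (fun s => slice X t s + a (t, s) * slice ℓ t s)
        + (4 * ν * lam + 4 * A2 * (e2 * ν)) * N2 (slice ℓ t))
        + (4 * N2 κ + 4 * A2 * K) * N2 (slice u t)) := by
          refine lintegral_mono fun t => ?_
          have h1 := slice_est ψ κ δ hψ (fun q => a (t, q)) (by fun_prop) A (fun q => haA _) Lip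
            hLip0 (hLip t) m hm u X ℓ t
          refine h1.trans ?_
          calc _ ≤ 4 * N2 ψ * (N2 (fun s => slice X t s + a (t, s) * slice ℓ t s)
              + lam * N2 (slice ℓ t)) + 4 * (N2 κ * N2 (slice u t))
              + 4 * A2 * (e2 * (ν * N2 (slice ℓ t)) + K * N2 (slice u t)) := by
                gcongr
                exact hD t
            _ = _ := by rw [← hν]; ring
      _ = _ := by
          rw [lintegral_add_right _ ((mS u).const_mul _),
            lintegral_add_left (mP.const_mul _), lintegral_const_mul _ mP,
            lintegral_const_mul _ (mS ℓ), lintegral_const_mul _ (mS u)]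
          rfl
  have hlow : ν * L ≤ 2 * (e2 * ν) * L + 2 * K * U + 2 * Mn := by
    calc ν * L = ∫⁻ t, ν * N2 (slice ℓ t) := by
          rw [lintegral_const_mul _ (mS ℓ)]; rfl
      _ ≤ ∫⁻ t, ((2 * (e2 * ν) * N2 (slice ℓ t) + 2 * K * N2 (slice u t)) + 2 *
          ∫⁻ q, ∫⁻ ζ, (ENNReal.ofReal (m ζ)) ^ 2 * ‖T ψ (slice u t) q ζ‖ₑ ^ 2) := by
          refine lintegral_mono fun t => ?_
          refine (lower_est ψ m hm hm0 u ℓ t).trans ?_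
          gcongr
          calc _ ≤ 2 * (e2 * (ν * N2 (slice ℓ t)) + K * N2 (slice u t)) := by
                gcongr; exact hD t
            _ = _ := by ring
      _ = _ := by
          have mm : Measurable fun t => 2 * (e2 * ν) * N2 (slice ℓ t) + 2 * K * N2 (slice u t) :=
            ((mS ℓ).const_mul _).add ((mS u).const_mul _)
          rw [lintegral_add_left mm,
            lintegral_add_left ((mS ℓ).const_mul _), lintegral_const_mul _ (mS ℓ),
            lintegral_const_mul _ (mS u), lintegral_const_mul' _ _ (by simp)]
          rfl
  have hfin : ν * L ≤ (8 * c1 * ν * Pn + B * U)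
      + (8 * c1 * lam + 8 * c1 * A2 * e2 + 2 * e2) * (ν * L) := by
    calc ν * L ≤ 2 * (e2 * ν) * L + 2 * K * U + 2 * (c1 * (4 * ν * Pn +
          (4 * ν * lam + 4 * A2 * (e2 * ν)) * L + (4 * N2 κ + 4 * A2 * K) * U)) := by
          refine hlow.trans ?_
          gcongr
      _ = _ := by simp only [hB]; ring
  have hY := absorb _ _ _ (ENNReal.mul_ne_top hνt hLt) hb hfin
  calc L = ν⁻¹ * (ν * L) := by
        rw [← mul_assoc, ENNReal.inv_mul_cancel hψ0 hνt, one_mul]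
    _ ≤ ν⁻¹ * (2 * (8 * c1 * ν * Pn + B * U)) := by gcongr
    _ ≤ ν⁻¹ * (2 * ((8 * c1 * ν + B) * (Pn + U))) := by
        gcongr
        calc 8 * c1 * ν * Pn + B * U ≤ (8 * c1 * ν * Pn + B * U) + (8 * c1 * ν * U + B * Pn) :=
              le_self_add
          _ = _ := by ring
    _ = _ := by ring

end P5
end KinMax

namespace KinMax
section P6
set_option linter.unusedSectionVars false
open scoped FourierTransform SchwartzMap InnerProductSpace ContDiff

lemma rpow_temperate {H : Type*} [NormedAddCommGroup H] [NormedSpace ℝ H] (f : H → ℝ)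
    (hf : f.HasTemperateGrowth) (hf2 : ∀ x, 1 / 2 < f x) (r : ℝ) :
    (fun x => f x ^ r).HasTemperateGrowth := by
  set t := {y : ℝ | 1 / 2 < y}
  have ht : Set.range f ⊆ t := by
    rintro - ⟨y, rfl⟩
    exact hf2 y
  have hdiff : ContDiffOn ℝ ∞ (fun x ↦ x ^ r) t :=
    contDiffOn_fun_id.rpow_const_of_ne fun x hx ↦ (lt_trans (by norm_num) hx).ne'
  have hunique : UniqueDiffOn ℝ t := (isOpen_lt' (1 / 2)).uniqueDiffOn
  apply Function.HasTemperateGrowth.comp' ht hunique hdiff _ hf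
  intro N
  /- Since `x ^ r` for negative `r` blows up near the origin (and we can't take
  `t := {y : ℝ | 1 / 2 < y}`), we have to choose `k` later than `N - r` times some factor depending
  on `t`. -/
  obtain ⟨k, hk⟩ := exists_nat_ge (max r <| (N - r) * Real.log 2 / (Real.log (3 / 2)))
  have hk₁ : r ≤ k := le_sup_left.trans hk
  have hk₂ : Real.log 2 * (N - r) ≤ (Real.log (3 / 2)) * k := by
    have := le_sup_right.trans hk
    field_simp at this
    grind
  use k, ∑ k ∈ Finset.range (N + 1), ‖Polynomial.eval r (descPochhammer ℝ k)‖, by positivity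
  intro n hn x hx
  have : ContDiffAt ℝ n (fun x ↦ x ^ r) x :=
    Real.contDiffAt_rpow_const <| Or.inl (lt_trans (by norm_num) hx).ne'
  -- We calculate the derivative of `x ^ r`.
  rw [norm_iteratedFDerivWithin_eq_norm_iteratedDerivWithin,
    iteratedDerivWithin_eq_iteratedDeriv hunique this hx, iteratedDeriv_eq_iterate,
    Real.iter_deriv_rpow_const, norm_mul]
  gcongr 1
  · have : n ∈ Finset.range (N + 1) := by grind
    apply Finset.single_le_sum (fun _ _ ↦ by positivity) this
  -- It remains to show that `‖x ^ (r - n)‖ ≤ (1 + ‖x‖) ^ k`: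
  have hx' : 1 / 2 < x := by simpa [t] using hx
  have hx'' : 0 < x := lt_of_lt_of_le (by norm_num) hx'.le
  simp only [Real.norm_eq_abs]
  apply (Real.abs_rpow_le_abs_rpow _ _).trans
  -- We consider the two cases `n ≤ r` and `r < n`.
  by_cases! h : 0 ≤ r - n
  · have : r - n ≤ k := by simpa using hk₁.trans (by simp)
    rw [← Real.rpow_natCast]
    exact (Real.rpow_le_rpow (by positivity) (by simp) h).trans
      (Real.rpow_le_rpow_of_exponent_le (by simp) this)
  have h : 0 < n - r := by grind
  calc
    /- In the case `0 < n - r`, we need the factor `Real.log 2 / (Real.log (3 / 2))` to control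
    the growth near `‖x‖ = 1/2`. -/
    _ = x ^ (-(n - r)) := by
      rw [neg_sub]
      congr
      simpa using hx''.le
    _ ≤ (2 : ℝ) ^ (n - r) := by
      simp only [one_div, Set.mem_ofPred_eq, t] at hx
      rw [Real.rpow_neg_eq_inv_rpow]
      gcongr
      exact ((inv_lt_comm₀ hx'' (by norm_num)).mpr hx).le
    _ = Real.exp (Real.log 2 * (n - r)) := by
      rw [Real.rpow_def_of_pos]
      norm_num
    _ ≤ Real.exp (Real.log (3 / 2) * k) := by
      gcongr 1
      apply le_trans _ hk₂
      gcongr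
    _ ≤ (3 / 2) ^ k := by
      rw [← Real.rpow_natCast, Real.rpow_def_of_pos]
      norm_num
    _ ≤ _ := by
      gcongr
      grind


lemma Fsym_temperate (σ : ℝ) (w₀ : E n → ℝ) (hw : ContDiff ℝ (⊤ : ℕ∞) w₀)
    (hwout : ∀ η : E n, 2 ≤ ‖η‖ → w₀ η = 1)
    (hwin : ∀ η : E n, ‖η‖ ≤ 1 → w₀ η = 0) : (Fsym σ w₀).HasTemperateGrowth := by
  have h1 : (fun η => 1 - w₀ η).HasTemperateGrowth := by
    refine HasCompactSupport.hasTemperateGrowth ?_ (contDiff_const.sub hw)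
    refine HasCompactSupport.of_support_subset_isCompact (isCompact_closedBall (0 : E n) 2) ?_
    intro x hx
    by_contra h
    simp only [Metric.mem_closedBall, dist_zero_right, not_le] at h
    exact hx (by simp [hwout x h.le])
  have h2 : w₀.HasTemperateGrowth := by
    have : w₀ = fun η => 1 - (1 - w₀ η) := by ext; ring
    rw [this]; fun_prop
  let b : ContDiffBump (0 : E n) := ⟨3 / 4, 1, by norm_num, by norm_num⟩
  have hb : (fun η : E n => b η).HasTemperateGrowth :=
    b.hasCompactSupport.hasTemperateGrowth b.contDiff
  have hf : (fun η : E n => ‖η‖ ^ 2 + b η).HasTemperateGrowth := by fun_prop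
  have h3 := rpow_temperate _ hf (by
    intro x
    rcases le_or_gt ‖x‖ (3 / 4) with h | h
    · have := b.one_of_mem_closedBall (x := x) (by simpa [b] using h)
      simp only [this]; nlinarith [norm_nonneg x]
    · have := b.nonneg (x := x)
      nlinarith) σ
  have e : Fsym σ w₀ = fun η => (‖η‖ ^ 2 + b η) ^ σ * w₀ η + ‖η‖ ^ 2 * (1 - w₀ η) := by
    ext η
    unfold Fsym
    rcases le_or_gt ‖η‖ 1 with h | h
    · simp [hwin η h]
    · have hb0 : b η = 0 := b.zero_of_le_dist (by simpa [b] using h.le)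
      rw [hb0, add_zero, Real.rpow_mul (norm_nonneg _), Real.rpow_two]
  rw [e]; fun_prop

lemma pow_two_le_rpow {σ r : ℝ} (h1 : σ < 1) (hr : 0 ≤ r) (hr1 : r ≤ 1) (h0 : 0 < σ) :
    r ^ 2 ≤ r ^ (2 * σ) := by
  rcases hr.eq_or_lt with rfl | h
  · rw [Real.zero_rpow (by positivity)]; norm_num
  · rw [← Real.rpow_two]
    exact Real.rpow_le_rpow_of_exponent_ge h hr1 (by linarith)

lemma rpow_le_pow_two {σ r : ℝ} (h1 : σ < 1) (hr1 : 1 ≤ r) :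
    r ^ (2 * σ) ≤ r ^ 2 := by
  rw [← Real.rpow_two]
  exact Real.rpow_le_rpow_of_exponent_le hr1 (by linarith)

section
variable {σ : ℝ} {w₀ : E n → ℝ}

lemma Fsym_lower (hσ0 : 0 < σ) (hσ1 : σ < 1)
    (hw01 : ∀ η, 0 ≤ w₀ η ∧ w₀ η ≤ 1)
    (hwout : ∀ η : E n, 2 ≤ ‖η‖ → w₀ η = 1)
    (hwin : ∀ η : E n, ‖η‖ ≤ 1 → w₀ η = 0)
    (η : E n) : min (‖η‖ ^ 2) (‖η‖ ^ (2 * σ)) ≤ Fsym σ w₀ η := by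
  obtain ⟨a, b⟩ := hw01 η
  unfold Fsym
  have h1 := min_le_left (‖η‖ ^ 2) (‖η‖ ^ (2 * σ))
  have h2 := min_le_right (‖η‖ ^ 2) (‖η‖ ^ (2 * σ))
  nlinarith

lemma Fsym_upper (hσ0 : 0 < σ) (hσ1 : σ < 1)
    (hw01 : ∀ η, 0 ≤ w₀ η ∧ w₀ η ≤ 1)
    (hwout : ∀ η : E n, 2 ≤ ‖η‖ → w₀ η = 1)
    (hwin : ∀ η : E n, ‖η‖ ≤ 1 → w₀ η = 0)
    (η : E n) : Fsym σ w₀ η ≤ 4 * min (‖η‖ ^ 2) (‖η‖ ^ (2 * σ)) := by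
  obtain ⟨a, b⟩ := hw01 η
  have hp : 0 ≤ ‖η‖ ^ (2 * σ) := by positivity
  rcases le_or_gt ‖η‖ 1 with h | h
  · have := pow_two_le_rpow hσ1 (norm_nonneg η) h hσ0
    rw [min_eq_left this]
    simp only [Fsym, hwin η h]
    nlinarith [sq_nonneg ‖η‖]
  · have := rpow_le_pow_two hσ1 h.le
    rw [min_eq_right this]
    rcases le_or_gt 2 ‖η‖ with h2 | h2
    · simp only [Fsym, hwout η h2]
      nlinarith
    · have h3 : 1 ≤ ‖η‖ ^ (2 * σ) := Real.one_le_rpow h.le (by positivity)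
      have h4 : ‖η‖ ^ 2 ≤ 4 := by nlinarith
      unfold Fsym
      nlinarith

lemma Fsym_nonneg (hσ0 : 0 < σ) (hσ1 : σ < 1)
    (hw01 : ∀ η, 0 ≤ w₀ η ∧ w₀ η ≤ 1)
    (hwout : ∀ η : E n, 2 ≤ ‖η‖ → w₀ η = 1)
    (hwin : ∀ η : E n, ‖η‖ ≤ 1 → w₀ η = 0)
    (η : E n) : 0 ≤ Fsym σ w₀ η :=
  (le_min (by positivity) (by positivity)).trans (Fsym_lower hσ0 hσ1 hw01 hwout hwin η)

lemma Fsym_quarter (hσ0 : 0 < σ) (hσ1 : σ < 1)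
    (hw01 : ∀ η, 0 ≤ w₀ η ∧ w₀ η ≤ 1)
    (hwout : ∀ η : E n, 2 ≤ ‖η‖ → w₀ η = 1)
    (hwin : ∀ η : E n, ‖η‖ ≤ 1 → w₀ η = 0)
    (p q : E n) (h : ‖p‖ / 4 ≤ ‖q‖) : Fsym σ w₀ p / 64 ≤ Fsym σ w₀ q := by
  have h1 := Fsym_upper hσ0 hσ1 hw01 hwout hwin p
  have h2 := Fsym_lower hσ0 hσ1 hw01 hwout hwin q
  have h3 : min (‖p‖ ^ 2) (‖p‖ ^ (2 * σ)) / 16 ≤ min (‖q‖ ^ 2) (‖q‖ ^ (2 * σ)) := by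
    refine le_min ?_ ?_
    · have := min_le_left (‖p‖ ^ 2) (‖p‖ ^ (2 * σ))
      nlinarith [norm_nonneg p]
    · have := min_le_right (‖p‖ ^ 2) (‖p‖ ^ (2 * σ))
      have h5 : (‖p‖ / 4) ^ (2 * σ) ≤ ‖q‖ ^ (2 * σ) :=
        Real.rpow_le_rpow (by positivity) h (by positivity)
      rw [Real.div_rpow (norm_nonneg _) (by norm_num)] at h5
      have h6 : (4 : ℝ) ^ (2 * σ) ≤ 4 ^ 2 := rpow_le_pow_two hσ1 (by norm_num)
      have h7 : ‖p‖ ^ (2 * σ) / 4 ^ 2 ≤ ‖p‖ ^ (2 * σ) / 4 ^ (2 * σ) := by gcongr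
      norm_num at h7
      linarith
  linarith

lemma Fsym_M1 (hσ0 : 0 < σ) (hσ1 : σ < 1)
    (hw01 : ∀ η, 0 ≤ w₀ η ∧ w₀ η ≤ 1)
    (hwout : ∀ η : E n, 2 ≤ ‖η‖ → w₀ η = 1)
    (hwin : ∀ η : E n, ‖η‖ ≤ 1 → w₀ η = 0)
    (hc : Continuous (Fsym σ w₀)) (ξ η : E n) (s t : ℝ) (hst : s ≤ t) :
    1 / 384 * (t - s) * Fsym σ w₀ (η + (-t) • ξ) ≤ ∫ r in s..t, Fsym σ w₀ (η + (-r) • ξ) := by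
  have hF := Fsym_nonneg hσ0 hσ1 hw01 hwout hwin
  set p := η + (-t) • ξ with hp
  have key : ∀ a b, s ≤ a → a ≤ b → b ≤ t → (t - s) / 6 ≤ b - a →
      (∀ r ∈ Set.Icc a b, ‖p‖ / 4 ≤ ‖η + (-r) • ξ‖) →
      1 / 384 * (t - s) * Fsym σ w₀ p ≤ ∫ r in s..t, Fsym σ w₀ (η + (-r) • ξ) := by
    intro a b h1 h2 h3 h4 h5
    have hi : ∀ x y, IntervalIntegrable (fun r => Fsym σ w₀ (η + (-r) • ξ)) volume x y :=
      fun x y => (by fun_prop : Continuous fun r : ℝ => Fsym σ w₀ (η + (-r) • ξ)).intervalIntegrable x y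
    calc 1 / 384 * (t - s) * Fsym σ w₀ p = (t - s) / 6 * (Fsym σ w₀ p / 64) := by ring
      _ ≤ (b - a) * (Fsym σ w₀ p / 64) := by
          gcongr
          have := hF p; positivity
      _ = ∫ r in a..b, Fsym σ w₀ p / 64 := by simp; ring
      _ ≤ ∫ r in a..b, Fsym σ w₀ (η + (-r) • ξ) := by
          refine intervalIntegral.integral_mono_on h2 (by simp) (hi _ _) ?_
          intro r hr
          exact Fsym_quarter hσ0 hσ1 hw01 hwout hwin _ _ (h5 r hr)
      _ ≤ _ := by
          refine intervalIntegral.integral_mono_interval h1 h2 h3 ?_ (hi _ _)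
          exact Filter.Eventually.of_forall fun r => hF _
  have e : ∀ r, η + (-r) • ξ = p + (t - r) • ξ := by
    intro r; rw [hp]; module
  rcases le_or_gt (‖ξ‖ * (t - s)) (3 / 2 * ‖p‖) with h | h
  · refine key (t - (t - s) / 2) t (by linarith) (by linarith) le_rfl (by linarith) ?_
    intro r hr
    have h1 := norm_sub_norm_le p (-((t - r) • ξ))
    rw [sub_neg_eq_add, ← e, norm_neg, norm_smul, Real.norm_eq_abs,
      abs_of_nonneg (by linarith [hr.2])] at h1
    have : (t - r) * ‖ξ‖ ≤ (t - s) / 2 * ‖ξ‖ := by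
      gcongr; linarith [hr.1]
    nlinarith
  · refine key s (s + (t - s) / 6) le_rfl (by linarith) (by linarith) (by linarith) ?_
    intro r hr
    have h1 := norm_sub_norm_le ((t - r) • ξ) (-p)
    rw [sub_neg_eq_add, add_comm, ← e, norm_neg, norm_smul, Real.norm_eq_abs,
      abs_of_nonneg (by linarith [hr.2])] at h1
    have : (5 * (t - s) / 6) * ‖ξ‖ ≤ (t - r) * ‖ξ‖ := by
      gcongr; linarith [hr.2]
    nlinarith

lemma Fsym_close (hσ0 : 0 < σ) (hσ1 : σ < 1)
    (hw01 : ∀ η, 0 ≤ w₀ η ∧ w₀ η ≤ 1)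
    (hwout : ∀ η : E n, 2 ≤ ‖η‖ → w₀ η = 1)
    (hwin : ∀ η : E n, ‖η‖ ≤ 1 → w₀ η = 0)
    (η : E n) : |Fsym σ w₀ η - ‖η‖ ^ (2 * σ)| ≤ 4 := by
  rcases le_or_gt 2 ‖η‖ with h | h
  · simp [Fsym, hwout η h]
  · obtain ⟨a, b⟩ := hw01 η
    have h1 : ‖η‖ ^ 2 ≤ 4 := by nlinarith [norm_nonneg η]
    have h2 : ‖η‖ ^ (2 * σ) ≤ 4 := by
      calc ‖η‖ ^ (2 * σ) ≤ 2 ^ (2 * σ) :=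
            Real.rpow_le_rpow (norm_nonneg _) h.le (by positivity)
        _ ≤ 2 ^ 2 := rpow_le_pow_two hσ1 (by norm_num)
        _ = 4 := by norm_num
    have h3 : 0 ≤ ‖η‖ ^ (2 * σ) := by positivity
    have h4 : 0 ≤ ‖η‖ ^ 2 := by positivity
    have : Fsym σ w₀ η - ‖η‖ ^ (2 * σ) = (1 - w₀ η) * (‖η‖ ^ 2 - ‖η‖ ^ (2 * σ)) := by
      unfold Fsym; ring
    rw [this, abs_mul, abs_of_nonneg (by linarith : 0 ≤ 1 - w₀ η)]
    have : |‖η‖ ^ 2 - ‖η‖ ^ (2 * σ)| ≤ 4 := abs_le.2 ⟨by linarith, by linarith⟩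
    nlinarith [abs_nonneg (‖η‖ ^ 2 - ‖η‖ ^ (2 * σ))]

lemma rpow_add_bound (hσ0 : 0 < σ) (hσ1 : σ < 1) (ε : ℝ) (hε : 0 < ε) : ∃ C ≥ 0, ∀ x y : ℝ, 0 ≤ x → 0 ≤ y →
    (x + y) ^ (2 * σ) ≤ (1 + ε) * x ^ (2 * σ) + C * y ^ (2 * σ) := by
  set κ := min 1 (ε / 3)
  have hκ : 0 < κ := by positivity
  have hκ2 : (1 + κ) ^ 2 ≤ 1 + ε := by
    have h1 : κ ≤ 1 := min_le_left _ _
    have h2 : κ ≤ ε / 3 := min_le_right _ _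
    nlinarith
  refine ⟨(1 + 1 / κ) ^ 2, by positivity, fun x y hx hy => ?_⟩
  have hxp : 0 ≤ x ^ (2 * σ) := by positivity
  have hyp : 0 ≤ y ^ (2 * σ) := by positivity
  have hs : 0 ≤ 2 * σ := by positivity
  rcases le_or_gt y (κ * x) with h | h
  · calc (x + y) ^ (2 * σ) ≤ ((1 + κ) * x) ^ (2 * σ) :=
          Real.rpow_le_rpow (by positivity) (by linarith) hs
      _ = (1 + κ) ^ (2 * σ) * x ^ (2 * σ) := Real.mul_rpow (by positivity) hx
      _ ≤ (1 + κ) ^ 2 * x ^ (2 * σ) := by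
          gcongr; exact rpow_le_pow_two hσ1 (by linarith)
      _ ≤ (1 + ε) * x ^ (2 * σ) := by gcongr
      _ ≤ _ := by
          have : 0 ≤ (1 + 1 / κ) ^ 2 * y ^ (2 * σ) := by positivity
          linarith
  · have hx2 : x ≤ 1 / κ * y := by
      rw [one_div, ← div_eq_inv_mul, le_div_iff₀ hκ]; linarith
    calc (x + y) ^ (2 * σ) ≤ ((1 + 1 / κ) * y) ^ (2 * σ) :=
          Real.rpow_le_rpow (by positivity) (by linarith) hs
      _ = (1 + 1 / κ) ^ (2 * σ) * y ^ (2 * σ) := Real.mul_rpow (by positivity) hy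
      _ ≤ (1 + 1 / κ) ^ 2 * y ^ (2 * σ) := by
          gcongr
          have : 0 ≤ 1 / κ := by positivity
          exact rpow_le_pow_two hσ1 (by linarith)
      _ ≤ _ := by
          have : 0 ≤ (1 + ε) * x ^ (2 * σ) := by positivity
          linarith

lemma Fsym_M2 (hσ0 : 0 < σ) (hσ1 : σ < 1)
    (hw01 : ∀ η, 0 ≤ w₀ η ∧ w₀ η ≤ 1)
    (hwout : ∀ η : E n, 2 ≤ ‖η‖ → w₀ η = 1)
    (hwin : ∀ η : E n, ‖η‖ ≤ 1 → w₀ η = 0)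
    (ε : ℝ) (hε : 0 < ε) : ∃ C ≥ 0, ∀ ζ θ : E n,
    |Fsym σ w₀ ζ - Fsym σ w₀ (ζ + θ)| ≤ ε * Fsym σ w₀ (ζ + θ) + C * (1 + ‖θ‖) ^ 2 := by
  obtain ⟨C, hC, h⟩ := rpow_add_bound hσ0 hσ1 ε hε
  refine ⟨C + 8 + 4 * ε, by positivity, fun ζ θ => ?_⟩
  have hs : 0 ≤ 2 * σ := by positivity
  have c1 := abs_le.1 (Fsym_close hσ0 hσ1 hw01 hwout hwin ζ)
  have c2 := abs_le.1 (Fsym_close hσ0 hσ1 hw01 hwout hwin (ζ + θ))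
  have t1 : ‖ζ + θ‖ ≤ ‖ζ‖ + ‖θ‖ := norm_add_le _ _
  have t2 : ‖ζ‖ ≤ ‖ζ + θ‖ + ‖θ‖ := by
    have := norm_sub_le (ζ + θ) θ
    simpa using this
  have b1 := (Real.rpow_le_rpow (norm_nonneg _) t1 hs).trans
    (h _ _ (norm_nonneg ζ) (norm_nonneg θ))
  have b2 := (Real.rpow_le_rpow (norm_nonneg _) t2 hs).trans
    (h _ _ (norm_nonneg (ζ + θ)) (norm_nonneg θ))
  have b3 : ‖θ‖ ^ (2 * σ) ≤ (1 + ‖θ‖) ^ 2 :=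
    (Real.rpow_le_rpow (norm_nonneg _) (by linarith) hs).trans
      (rpow_le_pow_two hσ1 (by linarith [norm_nonneg θ]))
  have b4 : 1 ≤ (1 + ‖θ‖) ^ 2 := one_le_pow₀ (by linarith [norm_nonneg θ])
  have b5 : C * ‖θ‖ ^ (2 * σ) ≤ C * (1 + ‖θ‖) ^ 2 := by gcongr
  have b6 : (8 + 4 * ε) * 1 ≤ (8 + 4 * ε) * (1 + ‖θ‖) ^ 2 := by gcongr
  have b7 : ε * (‖ζ + θ‖ ^ (2 * σ)) ≤ ε * (Fsym σ w₀ (ζ + θ) + 4) := by gcongr; linarith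
  rw [abs_le]
  constructor
  · rcases le_total ‖ζ‖ ‖ζ + θ‖ with hh | hh
    · have b8 : ε * ‖ζ‖ ^ (2 * σ) ≤ ε * ‖ζ + θ‖ ^ (2 * σ) := by gcongr
      nlinarith
    · have b8 : ‖ζ + θ‖ ^ (2 * σ) ≤ ‖ζ‖ ^ (2 * σ) := by gcongr
      have b9 : 0 ≤ ε * ‖ζ + θ‖ ^ (2 * σ) := by positivity
      have b10 : 0 ≤ C * (1 + ‖θ‖) ^ 2 := by positivity
      nlinarith
  · nlinarith

end
end P6
end KinMax

namespace KinMax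
section P7
set_option linter.unusedSectionVars false
open scoped FourierTransform SchwartzMap InnerProductSpace ContDiff

/-- phase space in `(x,v)` -/
abbrev PV (n : ℕ) : Type := EuclideanSpace ℝ (Fin n ⊕ Fin n)

/-- splitting off time -/
def JL (n : ℕ) : Z n ≃ₗ[ℝ] ℝ × PV n where
  toFun z := (z (Sum.inl ()), WithLp.toLp 2 fun j => z (Sum.inr j))
  invFun p := WithLp.toLp 2 (Sum.elim (fun _ => p.1) p.2)
  map_add' x y := by ext <;> simp
  map_smul' c x := by ext <;> simp
  left_inv z := by
    ext (i | i) <;> simp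
  right_inv p := by
    ext <;> simp

/-- splitting off time, continuous version -/
def J (n : ℕ) : Z n ≃L[ℝ] ℝ × PV n := (JL n).toContinuousLinearEquiv

lemma J_apply (z : Z n) : J n z = (z (Sum.inl ()), WithLp.toLp 2 fun j => z (Sum.inr j)) := rfl

lemma J_symm_apply (p : ℝ × PV n) :
    (J n).symm p = WithLp.toLp 2 (Sum.elim (fun _ => p.1) p.2) := rfl

lemma J_mp : MeasurePreserving (J n) := by
  have h1 := PiLp.volume_preserving_ofLp (Unit ⊕ Fin n ⊕ Fin n)
  have h2 := volume_measurePreserving_sumPiEquivProdPi (fun _ : Unit ⊕ Fin n ⊕ Fin n => ℝ)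
  have h3 := (volume_preserving_funUnique Unit ℝ).prod
    (PiLp.volume_preserving_toLp (Fin n ⊕ Fin n))
  exact (h3.comp h2).comp h1

lemma J_symm_mp : MeasurePreserving (J n).symm :=
  J_mp.symm (J n).toHomeomorph.toMeasurableEquiv

/-- transport generator -/
def NL (n : ℕ) : PV n →ₗ[ℝ] PV n where
  toFun q := WithLp.toLp 2 (Sum.elim (fun i => q (Sum.inr i)) fun _ => 0)
  map_add' x y := by ext (i | i) <;> simp
  map_smul' c x := by ext (i | i) <;> simp

/-- adjoint of the transport generator -/
def NL' (n : ℕ) : PV n →ₗ[ℝ] PV n where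
  toFun q := WithLp.toLp 2 (Sum.elim (fun _ => 0) fun i => q (Sum.inl i))
  map_add' x y := by ext (i | i) <;> simp
  map_smul' c x := by ext (i | i) <;> simp

/-- reflection of the velocity -/
def SL (n : ℕ) : PV n →ₗ[ℝ] PV n where
  toFun q := WithLp.toLp 2 (Sum.elim (fun i => q (Sum.inl i)) fun i => - q (Sum.inr i))
  map_add' x y := by ext (i | i) <;> simp [add_comm]
  map_smul' c x := by ext (i | i) <;> simp

/-- transport generator, continuous -/
def Nc (n : ℕ) : PV n →L[ℝ] PV n := LinearMap.toContinuousLinearMap (NL n)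
/-- adjoint, continuous -/
def Nc' (n : ℕ) : PV n →L[ℝ] PV n := LinearMap.toContinuousLinearMap (NL' n)

lemma Nc_apply (q : PV n) :
  Nc n q = WithLp.toLp 2 (Sum.elim (fun i => q (Sum.inr i)) fun _ => 0) := rfl
lemma Nc'_apply (q : PV n) :
  Nc' n q = WithLp.toLp 2 (Sum.elim (fun _ => 0) fun i => q (Sum.inl i)) := rfl
lemma SL_apply (q : PV n) :
  SL n q = WithLp.toLp 2 (Sum.elim (fun i => q (Sum.inl i)) fun i => - q (Sum.inr i)) := rfl

lemma Nc_sq (q : PV n) : Nc n (Nc n q) = 0 := by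
  ext (i | i) <;> simp [Nc_apply]

lemma Nc'_sq (q : PV n) : Nc' n (Nc' n q) = 0 := by
  ext (i | i) <;> simp [Nc'_apply]

lemma Nc_adj (x y : PV n) : ⟪Nc n x, y⟫_ℝ = ⟪x, Nc' n y⟫_ℝ := by
  simp [PiLp.inner_apply, Nc_apply, Nc'_apply]

lemma flow_mp {V : Type*} [NormedAddCommGroup V] [InnerProductSpace ℝ V] [FiniteDimensional ℝ V]
    [MeasurableSpace V] [BorelSpace V] (N : V →L[ℝ] V) (hN : ∀ q, N (N q) = 0)
    (S : V →ₗ[ℝ] V) (hS : ∀ q, S (S q) = q) (hSN : ∀ q, S (N q) = - N (S q)) (t : ℝ) :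
    MeasurePreserving (flow N t) := by
  let f : ℝ → V →ₗ[ℝ] V := fun t => LinearMap.id + t • (N : V →ₗ[ℝ] V)
  have hf : ∀ t q, f t q = q + t • N q := fun t q => rfl
  have hadd : ∀ s t, f s * f t = f (s + t) := by
    intro s t
    ext q
    simp only [Module.End.mul_apply, hf, map_add, map_smul, hN]
    module
  have h0 : f 0 = 1 := by ext q; simp [hf]
  have hdet : ∀ s t, LinearMap.det (f s) * LinearMap.det (f t) = LinearMap.det (f (s + t)) := by
    intro s t; rw [← hadd, map_mul]
  let Se : V ≃ₗ[ℝ] V := LinearEquiv.ofInvolutive S hS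
  have hneg : ∀ t, LinearMap.det (f (-t)) = LinearMap.det (f t) := by
    intro t
    rw [← LinearMap.det_conj (f t) Se]
    congr 1
    ext q
    have e1 : ∀ q, Se q = S q := fun q => rfl
    have e2 : Se.symm q = S q := rfl
    simp only [LinearMap.comp_apply, LinearEquiv.coe_coe, e1, e2, hf, map_add, map_smul, hS, hSN]
    simp
  have hd : LinearMap.det (f t) = 1 := by
    have h1 := hdet t (-t)
    rw [hneg, add_neg_cancel, h0, map_one] at h1
    have h2 := hdet (t / 2) (t / 2)
    rw [add_halves] at h2
    nlinarith [mul_self_nonneg (LinearMap.det (f (t / 2)))]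
  have hm := Measure.map_linearMap_addHaar_eq_smul_addHaar (volume : Measure V)
    (f := f t) (by rw [hd]; norm_num)
  rw [hd] at hm
  have hc : Continuous (flow N t) := by unfold flow; fun_prop
  refine ⟨hc.measurable, ?_⟩
  have : flow N t = f t := rfl
  rw [this, hm]; simp

lemma SL_sq (q : PV n) : SL n (SL n q) = q := by
  ext (i | i) <;> simp [SL_apply]

lemma Nc_mp (t : ℝ) : MeasurePreserving (flow (Nc n) t) :=
  flow_mp _ Nc_sq (SL n) SL_sq (by intro q; ext (i | i) <;> simp [SL_apply, Nc_apply]) t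

lemma Nc'_mp (t : ℝ) : MeasurePreserving (flow (Nc' n) t) :=
  flow_mp _ Nc'_sq (SL n) SL_sq (by intro q; ext (i | i) <;> simp [SL_apply, Nc'_apply]) t

/-- first half -/
def fstL (q : PV n) : E n := WithLp.toLp 2 fun i => q (Sum.inl i)
/-- second half -/
def sndL (q : PV n) : E n := WithLp.toLp 2 fun i => q (Sum.inr i)

lemma sndL_flow (t : ℝ) (q : PV n) : sndL (flow (Nc' n) t q) = sndL q + t • fstL q := by
  ext i; simp [sndL, fstL, flow, Nc'_apply]

lemma sndL_add (p q : PV n) : sndL (p + q) = sndL p + sndL q := rfl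

lemma sndL_norm (q : PV n) : ‖sndL q‖ ≤ ‖q‖ := by
  rw [EuclideanSpace.norm_eq, EuclideanSpace.norm_eq]
  apply Real.sqrt_le_sqrt
  rw [Fintype.sum_sum_type]
  have : 0 ≤ ∑ i : Fin n, ‖q (Sum.inl i)‖ ^ 2 := by positivity
  simpa [sndL] using this

lemma sndL_cont : Continuous (sndL : PV n → E n) := by
  unfold sndL; fun_prop

lemma vC_J_symm (p : ℝ × PV n) : vC ((J n).symm p) = sndL p.2 := rfl

lemma inner_J_symm (p r : ℝ × PV n) :
    ⟪(J n).symm p, (J n).symm r⟫_ℝ = ⟪p.1, r.1⟫_ℝ + ⟪p.2, r.2⟫_ℝ := by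
  simp [PiLp.inner_apply, J_symm_apply, Fintype.sum_sum_type]

end P7
end KinMax

namespace KinMax
section P8
set_option linter.unusedSectionVars false
open scoped FourierTransform SchwartzMap InnerProductSpace

/-- transfer to `ℝ × PV` -/
def tr (u : 𝓢(Z n, ℂ)) : 𝓢(ℝ × PV n, ℂ) :=
  SchwartzMap.compCLMOfContinuousLinearEquiv ℂ (J n).symm u

lemma tr_apply (u : 𝓢(Z n, ℂ)) (p : ℝ × PV n) : tr u p = u ((J n).symm p) := rfl

lemma tr_integrable (u : 𝓢(Z n, ℂ)) : Integrable (tr u) := by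
  have h := (J_symm_mp (n := n)).integrable_comp_emb
    (J n).symm.toHomeomorph.measurableEmbedding (g := u)
  exact h.2 u.integrable

lemma slice_fourier (U : 𝓢(ℝ × PV n, ℂ)) (t : ℝ) (ζ : PV n) :
    𝓕 (slice U t) ζ = ∫ q, 𝐞 (-⟪q, ζ⟫_ℝ) • U (t, q) := by
  rw [SchwartzMap.fourier_coe, Real.fourier_eq]; rfl

lemma slice_fourier_cont (U : 𝓢(ℝ × PV n, ℂ)) (ζ : PV n) :
    Continuous fun t => 𝓕 (slice U t) ζ := by
  simp_rw [slice_fourier]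
  obtain ⟨K, hK0, hK⟩ := schwartz_japa U
  apply continuous_of_dominated
    (bound := fun s => K * 1 ^ (Module.finrank ℝ (PV n) + 1) * japa s)
  · intro x
    apply Continuous.aestronglyMeasurable
    fun_prop
  · intro x
    refine Filter.Eventually.of_forall fun s => ?_
    rw [Circle.norm_smul]
    exact hK 1 s (x, s) le_rfl (by simp)
  · exact japa_integrable.const_mul _
  · refine Filter.Eventually.of_forall fun s => ?_
    fun_prop

lemma phase_integrable (u : 𝓢(Z n, ℂ)) (τ : ℝ) (ζ : PV n) :
    Integrable (fun p : ℝ × PV n => 𝐞 (-(⟪p.1, τ⟫_ℝ + ⟪p.2, ζ⟫_ℝ)) • tr u p) := by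
  refine (tr_integrable u).norm.mono' ?_ ?_
  · apply Continuous.aestronglyMeasurable
    fun_prop
  · refine Filter.Eventually.of_forall fun s => ?_
    rw [Circle.norm_smul]

lemma slice_fourier_integrable (u : 𝓢(Z n, ℂ)) (ζ : PV n) :
    Integrable fun t => 𝓕 (slice (tr u) t) ζ := by
  simp_rw [slice_fourier]
  have h := phase_integrable u 0 ζ
  simp only [inner_zero_right, zero_add] at h
  exact Integrable.integral_prod_left h

lemma fourier_tr (u : 𝓢(Z n, ℂ)) (τ : ℝ) (ζ : PV n) :
    𝓕 (fun t => 𝓕 (slice (tr u) t) ζ) τ = 𝓕 u ((J n).symm (τ, ζ)) := by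
  rw [SchwartzMap.fourier_coe, Real.fourier_eq, Real.fourier_eq]
  have h := (J_symm_mp (n := n)).integral_comp
    (J n).symm.toHomeomorph.measurableEmbedding
    (fun v => 𝐞 (-⟪v, (J n).symm (τ, ζ)⟫_ℝ) • u v)
  have h' : ∫ p : ℝ × PV n, 𝐞 (-(⟪p.1, τ⟫_ℝ + ⟪p.2, ζ⟫_ℝ)) • tr u p =
      ∫ v, 𝐞 (-⟪v, (J n).symm (τ, ζ)⟫_ℝ) • u v := by
    rw [← h]
    refine integral_congr_ae (Filter.Eventually.of_forall fun p => ?_)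
    simp only
    rw [inner_J_symm]; rfl
  rw [← h', Measure.volume_eq_prod, integral_prod _ (phase_integrable u τ ζ)]
  refine integral_congr_ae (Filter.Eventually.of_forall fun t => ?_)
  simp only [slice_fourier]
  rw [Circle.smul_def, ← integral_smul]
  refine integral_congr_ae (Filter.Eventually.of_forall fun q => ?_)
  simp only
  rw [← Circle.smul_def, smul_smul, ← AddChar.map_add_eq_mul]
  congr 2; ring

/-- slicing commutes with multipliers depending on `η` only -/
lemma slice_mult (u l : 𝓢(Z n, ℂ)) (m : E n → ℝ)
    (h : ∀ y, 𝓕 l y = (m (vC y) : ℂ) * 𝓕 u y) (t : ℝ) (ζ : PV n) :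
    𝓕 (slice (tr l) t) ζ = (m (sndL ζ) : ℂ) * 𝓕 (slice (tr u) t) ζ := by
  set g : ℝ → ℂ := fun t => 𝓕 (slice (tr l) t) ζ - (m (sndL ζ) : ℂ) * 𝓕 (slice (tr u) t) ζ with hg
  have hgc : Continuous g := (slice_fourier_cont _ ζ).sub
    (continuous_const.mul (slice_fourier_cont _ ζ))
  have hgi : Integrable g := (slice_fourier_integrable l ζ).sub
    ((slice_fourier_integrable u ζ).const_mul _)
  have hF : 𝓕 g = 0 := by
    ext τ
    have e1 := fourier_tr l τ ζ
    have e2 := fourier_tr u τ ζ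
    rw [h, vC_J_symm, ← e2] at e1
    rw [Real.fourier_eq] at e1 e2 ⊢
    rw [Real.fourier_eq] at e1
    have i1 : Integrable fun v : ℝ => 𝐞 (-⟪v, τ⟫_ℝ) • 𝓕 (slice (tr l) v) ζ := by
      refine (slice_fourier_integrable l ζ).norm.mono' ?_ ?_
      · apply Continuous.aestronglyMeasurable
        have := slice_fourier_cont (tr l) ζ
        fun_prop
      · exact Filter.Eventually.of_forall fun s => by rw [Circle.norm_smul]
    have i2 : Integrable fun v : ℝ => 𝐞 (-⟪v, τ⟫_ℝ) • 𝓕 (slice (tr u) v) ζ := by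
      refine (slice_fourier_integrable u ζ).norm.mono' ?_ ?_
      · apply Continuous.aestronglyMeasurable
        have := slice_fourier_cont (tr u) ζ
        fun_prop
      · exact Filter.Eventually.of_forall fun s => by rw [Circle.norm_smul]
    have : ∀ v : ℝ, 𝐞 (-⟪v, τ⟫_ℝ) • g v = 𝐞 (-⟪v, τ⟫_ℝ) • 𝓕 (slice (tr l) v) ζ
        - (m (sndL ζ) : ℂ) * (𝐞 (-⟪v, τ⟫_ℝ) • 𝓕 (slice (tr u) v) ζ) := by
      intro v; simp only [hg, Circle.smul_def, smul_eq_mul]; ring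
    simp_rw [this]
    rw [integral_sub i1 (i2.const_mul _), integral_const_mul, e1]
    simp
  have hinv := hgc.fourierInv_fourier_eq hgi (by rw [hF]; exact integrable_zero _ _ _)
  have : g t = 0 := by
    rw [← hinv, hF, Real.fourierInv_eq]; simp
  exact sub_eq_zero.1 this

/-- the multiplier as a Schwartz function -/
lemma fracLap_schwartz (σ : ℝ) (w₀ : E n → ℝ) (hF : (Fsym σ w₀).HasTemperateGrowth)
    (u : 𝓢(Z n, ℂ)) : ∃ l : 𝓢(Z n, ℂ), (l : Z n → ℂ) = fracLap σ w₀ u ∧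
      ∀ y, 𝓕 l y = (Fsym σ w₀ (vC y) : ℂ) * 𝓕 u y := by
  let vL : Z n →ₗ[ℝ] E n :=
    { toFun := vC, map_add' := fun _ _ => rfl, map_smul' := fun _ _ => rfl }
  have hv : (vC : Z n → E n).HasTemperateGrowth :=
    (LinearMap.toContinuousLinearMap vL).hasTemperateGrowth
  have hm : (fun y : Z n => (Fsym σ w₀ (vC y) : ℂ)).HasTemperateGrowth := by
    have h1 := Function.HasTemperateGrowth.comp hF hv
    exact Function.HasTemperateGrowth.comp Complex.ofRealCLM.hasTemperateGrowth h1
  refine ⟨𝓕⁻ (SchwartzMap.smulLeftCLM ℂ (fun y : Z n => (Fsym σ w₀ (vC y) : ℂ)) (𝓕 u)), ?_, ?_⟩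
  · rw [SchwartzMap.fourierInv_coe]
    unfold fracLap
    congr 1
    ext y
    rw [SchwartzMap.smulLeftCLM_apply_apply hm, smul_eq_mul, SchwartzMap.fourier_coe]
  · intro y
    rw [FourierTransform.fourier_fourierInv_eq, SchwartzMap.smulLeftCLM_apply_apply hm, smul_eq_mul]

end P8
end KinMax

namespace KinMax
section P9
set_option linter.unusedSectionVars false
open scoped FourierTransform SchwartzMap InnerProductSpace

lemma dir_eq (t : ℝ) (q : PV n) : (J n).symm (1, Nc n q) =
    eT + ∑ i : Fin n, (vC ((J n).symm (t, q)) i) • eX i := by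
  ext (j | j | j)
  · simp [J_symm_apply, Nc_apply, eT, eX, vC]
  · simp [J_symm_apply, Nc_apply, eT, eX, vC, Finset.sum_ite_eq, Pi.single_apply]
  · simp [J_symm_apply, Nc_apply, eT, eX, vC]

/-- the transport derivative -/
def X0 (u : Z n → ℂ) (z : Z n) : ℂ :=
  fderiv ℝ u z eT + ∑ i : Fin n, (vC z i : ℂ) * fderiv ℝ u z (eX i)

lemma exists_X (u : 𝓢(Z n, ℂ)) : ∃ X : 𝓢(ℝ × PV n, ℂ),
    (∀ t q, X (t, q) = fderiv ℝ (tr u) (t, q) (1, Nc n q)) ∧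
    ∀ t q, X (t, q) = X0 u ((J n).symm (t, q)) := by
  have hg : (fun p : ℝ × PV n => ((1, Nc n p.2) : ℝ × PV n)).HasTemperateGrowth := by
    have e : (fun p : ℝ × PV n => ((1, Nc n p.2) : ℝ × PV n)) = fun p =>
        ((1, 0) : ℝ × PV n) + (ContinuousLinearMap.inr ℝ ℝ (PV n) ∘L Nc n ∘L
          ContinuousLinearMap.snd ℝ ℝ (PV n)) p := by
      ext p <;> simp
    rw [e]
    exact (Function.HasTemperateGrowth.const _).add (ContinuousLinearMap.hasTemperateGrowth _)
  refine ⟨dirD _ hg (tr u), fun t q => dirD_apply _ _ _ _, fun t q => ?_⟩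
  rw [dirD_apply]
  have e : (tr u : ℝ × PV n → ℂ) = u ∘ (J n).symm := rfl
  rw [e, ContinuousLinearEquiv.comp_right_fderiv]
  simp only [ContinuousLinearMap.comp_apply, ContinuousLinearEquiv.coe_coe]
  rw [dir_eq t q]
  simp [X0, map_add, map_sum, map_smul]

lemma lint_transfer (f : Z n → ℂ) (hf : Continuous f) :
    ∫⁻ t, ∫⁻ q, ‖f ((J n).symm (t, q))‖ₑ ^ 2 = ∫⁻ z, ‖f z‖ₑ ^ 2 := by
  have hm : Measurable fun z => ‖f z‖ₑ ^ 2 := hf.measurable.enorm.pow_const 2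
  rw [← (J_symm_mp (n := n)).lintegral_comp hm, Measure.volume_eq_prod, lintegral_prod]
  exact (hm.comp (J n).symm.continuous.measurable).aemeasurable

lemma eLpNorm_sq (f : Z n → ℂ) : (eLpNorm f 2 volume) ^ 2 = ∫⁻ z, ‖f z‖ₑ ^ 2 := by
  rw [eLpNorm_eq_lintegral_rpow_enorm_toReal (by norm_num) (by norm_num)]
  rw [← ENNReal.rpow_natCast, ← ENNReal.rpow_mul]
  norm_num

lemma J_vec (p : ℝ × PV n) : tC ((J n).symm p) = p.1 := rfl

theorem main (σ : ℝ) (hσ0 : 0 < σ) (hσ1 : σ < 1)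
    (w₀ : E n → ℝ) (hw : ContDiff ℝ (⊤ : ℕ∞) w₀)
    (hw01 : ∀ η, 0 ≤ w₀ η ∧ w₀ η ≤ 1)
    (hwout : ∀ η : E n, 2 ≤ ‖η‖ → w₀ η = 1)
    (hwin : ∀ η : E n, ‖η‖ ≤ 1 → w₀ η = 0)
    (a : Z n → ℝ) (ha : ContDiff ℝ (⊤ : ℕ∞) a)
    (haB : ∀ k : ℕ, ∃ C : ℝ, ∀ z, ‖iteratedFDeriv ℝ k a z‖ ≤ C)
    (a₀ : ℝ) (ha₀ : 0 < a₀) (haLB : ∀ z, a₀ ≤ a z) :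
    ∃ C : ℝ, 0 < C ∧ ∀ u : 𝓢(Z n, ℂ),
      (∀ z : Z n, u z ≠ 0 → tC z ∈ Set.Icc (-3 : ℝ) 3) →
      eLpNorm (X0 u) 2 volume
        ≤ ENNReal.ofReal C *
          (eLpNorm (Pop σ w₀ a ⇑u) 2 volume + eLpNorm (⇑u) 2 volume) := by
  obtain ⟨A, hA⟩ := haB 0
  obtain ⟨B, hB⟩ := haB 1
  simp only [norm_iteratedFDeriv_zero] at hA
  simp only [norm_iteratedFDeriv_one] at hB
  have hA0 : 0 ≤ A := (norm_nonneg _).trans (hA 0)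
  have hB0 : 0 ≤ B := (norm_nonneg _).trans (hB 0)
  have hFt := Fsym_temperate σ w₀ hw hwout hwin
  have hFc : Continuous (Fsym σ w₀) := hFt.1.continuous
  have hLip : ∀ y z, ‖a y - a z‖ ≤ B * ‖y - z‖ := fun y z =>
    convex_univ.norm_image_sub_le_of_norm_fderiv_le (𝕜 := ℝ)
      (fun x _ => (ha.differentiable (by simp)).differentiableAt) (fun x _ => hB x)
      (Set.mem_univ _) (Set.mem_univ _)
  obtain ⟨C, hCt, hC⟩ := core (V := PV n) (N := Nc n) (N' := Nc' n) Nc_sq Nc_adj Nc_mp Nc'_mp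
    (fun ζ => Fsym σ w₀ (sndL ζ)) (hFc.comp sndL_cont)
    (fun ζ => Fsym_nonneg hσ0 hσ1 hw01 hwout hwin _) (1 / 384) (by norm_num)
    (by
      intro ζ s t hst
      simp only [sndL_flow]
      exact Fsym_M1 hσ0 hσ1 hw01 hwout hwin hFc _ _ s t hst)
    (by
      intro ε hε
      obtain ⟨C, hC, h⟩ := Fsym_M2 hσ0 hσ1 hw01 hwout hwin ε hε
      refine ⟨C, hC, fun ζ θ => ?_⟩
      simp only [sndL_add]
      refine (h _ _).trans ?_
      gcongr
      exact sndL_norm θ)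
    a₀ ha₀ A (B * ‖((J n).symm : ℝ × PV n →L[ℝ] Z n)‖) (by positivity)
    (fun p => a ((J n).symm p)) (ha.continuous.comp (J n).symm.continuous)
    (fun p => haLB _) (fun p => hA _)
    (by
      intro t q s
      refine (hLip _ _).trans ?_
      rw [mul_assoc, ← map_sub]
      gcongr
      have := ((J n).symm : ℝ × PV n →L[ℝ] Z n).le_opNorm ((t, q) - (t, s))
      simpa using this)
  refine ⟨1 + A * √C.toReal, by positivity, fun u hu => ?_⟩
  obtain ⟨l, hl, hlF⟩ := fracLap_schwartz σ w₀ hFt u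
  obtain ⟨X, hX1, hX2⟩ := exists_X u
  have hXc : Continuous (X0 u) := by
    have : X0 u = X ∘ J n := by
      ext z
      have := hX2 (J n z).1 (J n z).2
      simpa using this.symm
    rw [this]; exact X.continuous.comp (J n).continuous
  have hP : Pop σ w₀ a u = fun z => X0 u z + a z * l z := by
    ext z; unfold Pop X0; rw [hl]
  have hPc : Continuous (Pop σ w₀ a u) := by
    rw [hP]
    exact hXc.add ((Complex.continuous_ofReal.comp ha.continuous).mul l.continuous)
  have main := hC (tr u) X (tr l) hX1 (by
    intro t q ht
    by_contra h
    have : t ∈ Set.Icc (-3 : ℝ) 3 := hu ((J n).symm (t, q)) h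
    exact ht ⟨by linarith [this.1], by linarith [this.2]⟩) (slice_mult u l _ hlF)
  simp only [tr_apply, hX2] at main
  rw [lint_transfer l l.continuous, lint_transfer u u.continuous] at main
  have eP := lint_transfer _ hPc
  rw [hP] at eP
  simp only at eP
  rw [eP, ← eLpNorm_sq l, ← eLpNorm_sq u, ← eLpNorm_sq (fun z => X0 u z + a z * l z), ← hP] at main
  set p := eLpNorm (Pop σ w₀ a u) 2 volume
  set v := eLpNorm (⇑u) 2 volume
  have hlb : eLpNorm l 2 volume ≤ ENNReal.ofReal (√C.toReal) * (p + v) := by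
    have : (eLpNorm l 2 volume) ^ 2 ≤ (ENNReal.ofReal (√C.toReal) * (p + v)) ^ 2 := by
      refine main.trans ?_
      rw [mul_pow, ← ENNReal.ofReal_pow (by positivity), Real.sq_sqrt (by positivity),
        ENNReal.ofReal_toReal hCt]
      gcongr
      calc p ^ 2 + v ^ 2 ≤ (p ^ 2 + v ^ 2) + 2 * p * v := le_self_add
        _ = _ := by ring
    exact (ENNReal.pow_le_pow_left_iff (by norm_num)).1 this
  have hal : eLpNorm (fun z => (a z : ℂ) * l z) 2 volume ≤ ENNReal.ofReal A * eLpNorm l 2 volume := by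
    refine eLpNorm_le_mul_eLpNorm_of_ae_le_mul (Filter.Eventually.of_forall fun z => ?_) 2
    rw [norm_mul, Complex.norm_real]
    gcongr
    exact hA z
  have hXe : X0 u = Pop σ w₀ a u - fun z => (a z : ℂ) * l z := by
    ext z; rw [hP]; simp
  calc eLpNorm (X0 u) 2 volume ≤ p + eLpNorm (fun z => (a z : ℂ) * l z) 2 volume := by
        rw [hXe]
        refine eLpNorm_sub_le hPc.aestronglyMeasurable ?_ (by norm_num)
        exact ((Complex.continuous_ofReal.comp ha.continuous).mul
          l.continuous).aestronglyMeasurable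
    _ ≤ p + ENNReal.ofReal A * (ENNReal.ofReal (√C.toReal) * (p + v)) := by
        gcongr
        exact hal.trans (by gcongr)
    _ ≤ (p + v) + ENNReal.ofReal A * (ENNReal.ofReal (√C.toReal) * (p + v)) := by
        gcongr; exact le_self_add
    _ = _ := by
        rw [ENNReal.ofReal_add (by norm_num) (by positivity), ENNReal.ofReal_mul hA0,
          ENNReal.ofReal_one]
        ring

end P9
end KinMax

/-- maximal hypoelliptic estimate for the transport term,
for Schwartz functions supported in `[-3,3]` in the time variable. -/
theorem statement16
    (n : ℕ) (hn : 1 ≤ n) (σ : ℝ) (hσ0 : 0 < σ) (hσ1 : σ < 1)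
    (w₀ : E n → ℝ) (hw : ContDiff ℝ (⊤ : ℕ∞) w₀)
    (hw01 : ∀ η, 0 ≤ w₀ η ∧ w₀ η ≤ 1)
    (hwout : ∀ η : E n, 2 ≤ ‖η‖ → w₀ η = 1)
    (hwin : ∀ η : E n, ‖η‖ ≤ 1 → w₀ η = 0)
    (a : Z n → ℝ) (ha : ContDiff ℝ (⊤ : ℕ∞) a)
    (haB : ∀ k : ℕ, ∃ C : ℝ, ∀ z, ‖iteratedFDeriv ℝ k a z‖ ≤ C)
    (a₀ : ℝ) (ha₀ : 0 < a₀) (haLB : ∀ z, a₀ ≤ a z) :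
    ∃ C : ℝ, 0 < C ∧ ∀ u : SchwartzMap (Z n) ℂ,
      (∀ z : Z n, u z ≠ 0 → tC z ∈ Set.Icc (-3 : ℝ) 3) →
      eLpNorm (fun z : Z n =>
          fderiv ℝ (⇑u) z eT + ∑ i : Fin n, (vC z i : ℂ) * fderiv ℝ (⇑u) z (eX i)) 2 volume
        ≤ ENNReal.ofReal C *
          (eLpNorm (Pop σ w₀ a ⇑u) 2 volume + eLpNorm (⇑u) 2 volume) := by
  exact KinMax.main σ hσ0 hσ1 w₀ hw hw01 hwout hwin a ha haB a₀ ha₀ haLB
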